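/- Let M be a properly infinite von Neumann algebra and p ∈ M a properly infinite projection such that 1 − p is also properly infinite. Then the unitary orbit U_M(p) = {u p u* : u ∈ M unitary}, equipped with the operator-norm topology, is contractible. -/

import Mathlib

/-- A projection `e` in a von Neumann algebra `M ⊆ B(H)` is properly infinite:
there are `v, w ∈ M` with `v*v = w*w = e`, `vv* ≤ e`, `ww* ≤ e` and `vv*·ww* = 0`
(the order being the Loewner order on operators). -/
def IsProperlyInfiniteProj {H : Type*} [NormedAddCommGroup H]
    [InnerProductSpace ℂ H] [CompleteSpace H]
    (M : VonNeumannAlgebra H) (e : H →L[ℂ] H) : Prop :=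
  ∃ v ∈ M, ∃ w ∈ M, star v * v = e ∧ star w * w = e ∧
    v * star v ≤ e ∧ w * star w ≤ e ∧ (v * star v) * (w * star w) = 0


set_option linter.unusedSimpArgs false
namespace UOC

section Htpy

variable {A : Type*} [CStarAlgebra A] {K : Type*} [TopologicalSpace K]

/-- maps into the group of units that are null-homotopic -/
def Nul (A : Type*) [CStarAlgebra A] (K : Type*) [TopologicalSpace K] : Subgroup C(K, Aˣ) where
  carrier := {f | ∃ F : C(unitInterval × K, Aˣ), (∀ x, F (0, x) = f x) ∧ ∀ x, F (1, x) = 1}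
  mul_mem' := by
    rintro f g ⟨F, hF, hF'⟩ ⟨G, hG, hG'⟩
    exact ⟨F * G, fun x => by simp [hF, hG], fun x => by simp [hF', hG']⟩
  one_mem' := ⟨1, fun x => rfl, fun x => rfl⟩
  inv_mem' := by
    rintro f ⟨F, hF, hF'⟩
    exact ⟨F⁻¹, fun x => by simp [hF], fun x => by simp [hF']⟩

instance : (Nul A K).Normal where
  conj_mem := by
    rintro f ⟨F, hF, hF'⟩ g
    let G : C(unitInterval × K, Aˣ) := ⟨fun z => g z.2, by fun_prop⟩
    refine ⟨G * F * G⁻¹, fun x => ?_, fun x => ?_⟩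
    · simp [G, hF]
    · simp [hF', G]

/-- build a map to units -/
def mkU {X : Type*} [TopologicalSpace X] (f g : C(X, A)) (h1 : ∀ x, f x * g x = 1)
    (h2 : ∀ x, g x * f x = 1) : C(X, Aˣ) where
  toFun x := ⟨f x, g x, h1 x, h2 x⟩
  continuous_toFun := by
    rw [Units.continuous_iff]
    exact ⟨f.continuous, g.continuous⟩

lemma continuous_val (u : C(K, Aˣ)) : Continuous fun x => ((u x : Aˣ) : A) :=
  Units.continuous_val.comp u.continuous

lemma continuous_inv_val (u : C(K, Aˣ)) : Continuous fun x => (((u x)⁻¹ : Aˣ) : A) :=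
  Units.continuous_val.comp (u⁻¹).continuous

lemma shear (n : K → A) (hc : Continuous n) (hn : ∀ x, n x * n x = 0) :
    ∃ g ∈ Nul A K, ∀ x, ((g x : Aˣ) : A) = 1 + n x ∧ (((g x)⁻¹ : Aˣ) : A) = 1 - n x := by
  have key : ∀ (t : ℝ) (x : K), (1 + t • n x) * (1 - t • n x) = 1 ∧
      (1 - t • n x) * (1 + t • n x) = 1 := by
    intro t x
    constructor <;> simp [mul_add, add_mul, mul_sub, sub_mul, hn]
  let F : C(unitInterval × K, Aˣ) :=
    mkU ⟨fun z => 1 + (1 - (z.1 : ℝ)) • n z.2, by fun_prop⟩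
      ⟨fun z => 1 - (1 - (z.1 : ℝ)) • n z.2, by fun_prop⟩
      (fun z => (key _ _).1) (fun z => (key _ _).2)
  let g : C(K, Aˣ) := mkU ⟨fun x => 1 + n x, by fun_prop⟩ ⟨fun x => 1 - n x, by fun_prop⟩
    (fun x => by simpa using (key 1 x).1) (fun x => by simpa using (key 1 x).2)
  refine ⟨g, ⟨F, fun x => ?_, fun x => ?_⟩, fun x => ⟨rfl, rfl⟩⟩
  · ext; simp [F, g, mkU]
  · ext; simp [F, mkU]

lemma nearOne (n : K → A) (hc : Continuous n) (hn : ∀ x, ‖n x‖ < 1) :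
    ∃ g ∈ Nul A K, ∀ x, ((g x : Aˣ) : A) = 1 - n x := by
  have hb : ∀ z : unitInterval × K, ‖(1 - (z.1 : ℝ)) • n z.2‖ < 1 := by
    intro z
    have h1 := z.1.2.1
    have h2 := z.1.2.2
    calc ‖(1 - (z.1 : ℝ)) • n z.2‖ = |1 - (z.1 : ℝ)| * ‖n z.2‖ := norm_smul _ _
      _ ≤ 1 * ‖n z.2‖ := by
        gcongr; rw [abs_le]; constructor <;> linarith
      _ < 1 := by simpa using hn z.2
  let F : C(unitInterval × K, Aˣ) :=
    ⟨fun z => Units.oneSub ((1 - (z.1 : ℝ)) • n z.2) (hb z), by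
      rw [Units.isOpenEmbedding_val.isEmbedding.continuous_iff]
      change Continuous fun z : unitInterval × K => 1 - (1 - (z.1 : ℝ)) • n z.2
      fun_prop⟩
  let g : C(K, Aˣ) :=
    ⟨fun z => Units.oneSub (n z) (hn z), by
      rw [Units.isOpenEmbedding_val.isEmbedding.continuous_iff]
      change Continuous fun z : K => 1 - n z
      fun_prop⟩
  refine ⟨g, ⟨F, fun x => ?_, fun x => ?_⟩, fun x => rfl⟩
  · ext; simp [F, g]
  · ext; simp [F]

/-- conjugation by an isometry, extended by the identity -/
lemma amp_key (a : A) (ha : star a * a = 1) (y z : A) (h : y * z = 1) :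
    (1 + a * (y - 1) * star a) * (1 + a * (z - 1) * star a) = 1 := by
  have h1 : ∀ w, star a * (a * w) = w := fun w => by rw [← mul_assoc, ha, one_mul]
  have h2 : ∀ w, y * (z * w) = w := fun w => by rw [← mul_assoc, h, one_mul]
  simp only [mul_add, add_mul, mul_sub, sub_mul, mul_assoc, h1, h2, one_mul, mul_one]
  abel

def amp (a : A) (ha : star a * a = 1) (y : C(K, Aˣ)) : C(K, Aˣ) :=
  mkU ⟨fun x => 1 + a * ((y x : A) - 1) * star a, by have := continuous_val y; fun_prop⟩
    ⟨fun x => 1 + a * ((((y x)⁻¹ : Aˣ) : A) - 1) * star a, by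
      have := continuous_inv_val y; fun_prop⟩
    (fun x => amp_key a ha _ _ (by simp)) (fun x => amp_key a ha _ _ (by simp))

@[simp] lemma amp_val (a : A) (ha : star a * a = 1) (y : C(K, Aˣ)) (x : K) :
    ((amp a ha y x : Aˣ) : A) = 1 + a * ((y x : A) - 1) * star a := rfl

lemma amp_amp (a b : A) (ha : star a * a = 1) (hb : star b * b = 1)
    (hab : star (a * b) * (a * b) = 1) (y : C(K, Aˣ)) :
    amp a ha (amp b hb y) = amp (a * b) hab y := by
  ext x
  simp [mul_assoc]

lemma amp_mul (a : A) (ha : star a * a = 1) (y z : C(K, Aˣ)) :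
    amp a ha (y * z) = amp a ha y * amp a ha z := by
  ext x
  have h1 : ∀ w, star a * (a * w) = w := fun w => by rw [← mul_assoc, ha, one_mul]
  simp only [amp_val, ContinuousMap.mul_apply, Units.val_mul, mul_add, add_mul, mul_sub, sub_mul,
    mul_assoc, h1, one_mul, mul_one]
  abel

lemma amp_rot (a b : A) (ha : star a * a = 1) (hb : star b * b = 1) (hab : star a * b = 0)
    (y : C(K, Aˣ)) :
    (QuotientGroup.mk (amp a ha y) : C(K, Aˣ) ⧸ Nul A K) = QuotientGroup.mk (amp b hb y) := by
  have hba : star b * a = 0 := by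
    have := congrArg star hab
    simpa using this
  have ha' : ∀ w, star a * (a * w) = w := fun w => by rw [← mul_assoc, ha, one_mul]
  have hb' : ∀ w, star b * (b * w) = w := fun w => by rw [← mul_assoc, hb, one_mul]
  have hab' : ∀ w, star a * (b * w) = 0 := fun w => by rw [← mul_assoc, hab, zero_mul]
  have hba' : ∀ w, star b * (a * w) = 0 := fun w => by rw [← mul_assoc, hba, zero_mul]
  obtain ⟨g, hg, hgv⟩ := shear (K := K) (fun _ => b * star a) (by fun_prop)
    (fun x => by simp [mul_assoc, hab'])
  obtain ⟨h, hh, hhv⟩ := shear (K := K) (fun _ => -(a * star b)) (by fun_prop)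
    (fun x => by simp [mul_assoc, hba'])
  obtain ⟨r, hr, e⟩ : ∃ r ∈ Nul A K, r * amp a ha y = amp b hb y * r := by
    refine ⟨g * h * g, mul_mem (mul_mem hg hh) hg, ?_⟩
    ext x
    simp only [amp_val, ContinuousMap.mul_apply, Units.val_mul, (hgv x).1, (hhv x).1]
    simp only [mul_add, add_mul, mul_sub, sub_mul, mul_neg, neg_mul,
      mul_assoc, ha, hb, hab, hba, ha', hb', hab', hba', one_mul, mul_one, mul_zero, zero_mul]
    abel
  have e' := congrArg (QuotientGroup.mk : C(K, Aˣ) → C(K, Aˣ) ⧸ Nul A K) e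
  rw [QuotientGroup.mk_mul, QuotientGroup.mk_mul, (QuotientGroup.eq_one_iff _).2 hr] at e'
  simpa using e'

lemma swindle (Ψ : A →ₙ+* A) (hΨ : Continuous Ψ) (v w : A) (hv : star v * v = 1)
    (hw : star w * w = 1) (hvw : star v * w = 0)
    (hs : ∀ x, Ψ x = w * x * star w + v * Ψ x * star v)
    (a a' : A) (ha : star a * a = 1) (ha' : star a' * a' = 1) (haa : star a' * a = 0)
    (haw : star (a * w) * (a * w) = 1) (u : C(K, Aˣ)) : amp (a * w) haw u ∈ Nul A K := by
  have hwv : star w * v = 0 := by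
    have := congrArg star hvw
    simpa using this
  have haa' : star a * a' = 0 := by
    have := congrArg star haa
    simpa using this
  have hav : star (a * v) * (a * v) = 1 := by
    rw [star_mul, mul_assoc, ← mul_assoc (star a), ha, one_mul, hv]
  have key : ∀ y z : A, y * z = 1 → (1 + Ψ (y - 1)) * (1 + Ψ (z - 1)) = 1 := by
    intro y z h
    simp only [mul_add, add_mul, one_mul, mul_one]
    rw [← map_mul, sub_mul, mul_sub, h]
    simp only [one_mul, mul_one, map_sub]
    abel
  let Y : C(K, Aˣ) :=
    mkU ⟨fun x => 1 + Ψ ((u x : A) - 1), by have := continuous_val u; fun_prop⟩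
      ⟨fun x => 1 + Ψ ((((u x)⁻¹ : Aˣ) : A) - 1), by have := continuous_inv_val u; fun_prop⟩
      (fun x => key _ _ (by simp)) (fun x => key _ _ (by simp))
  have hY : ∀ x, ((Y x : Aˣ) : A) = 1 + Ψ ((u x : A) - 1) := fun x => rfl
  have e1 : Y = amp w hw u * amp v hv Y := by
    ext x
    have hwv' : ∀ z, star w * (v * z) = 0 := fun z => by rw [← mul_assoc, hwv, zero_mul]
    rw [ContinuousMap.mul_apply, Units.val_mul, amp_val, amp_val, hY, add_sub_cancel_left,
      mul_add, add_mul, add_mul, mul_one]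
    conv_lhs => rw [hs]
    simp only [mul_assoc, hwv', mul_zero, mul_one, one_mul]
    abel
  have e2 : amp a ha Y = amp (a * w) haw u * amp (a * v) hav Y := by
    conv_lhs => rw [e1]
    rw [amp_mul, amp_amp, amp_amp]
  have e3 := congrArg (QuotientGroup.mk : C(K, Aˣ) → C(K, Aˣ) ⧸ Nul A K) e2
  rw [amp_rot a a' ha ha' haa', QuotientGroup.mk_mul,
    amp_rot (a * v) a' hav ha' (by rw [star_mul, mul_assoc, haa', mul_zero])] at e3
  rw [← QuotientGroup.eq_one_iff]
  exact right_eq_mul.1 e3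

lemma kuiper1 (Ψ : A →ₙ+* A) (hΨ : Continuous Ψ) (v w : A) (hv : star v * v = 1)
    (hw : star w * w = 1) (hvw : star v * w = 0)
    (hs : ∀ x, Ψ x = w * x * star w + v * Ψ x * star v)
    (a a' : A) (ha : star a * a = 1) (ha' : star a' * a' = 1) (haa : star a' * a = 0)
    (u : C(K, Aˣ)) (hu : ∀ x, star a' * (u x : A) * a = 0) : u ∈ Nul A K := by
  have haa' : star a * a' = 0 := by
    have := congrArg star haa
    simpa using this
  have pa : ∀ w, star a * (a * w) = w := fun w => by rw [← mul_assoc, ha, one_mul]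
  have pb : ∀ w, star a' * (a' * w) = w := fun w => by rw [← mul_assoc, ha', one_mul]
  have pab : ∀ w, star a * (a' * w) = 0 := fun w => by rw [← mul_assoc, haa', zero_mul]
  have pba : ∀ w, star a' * (a * w) = 0 := fun w => by rw [← mul_assoc, haa, zero_mul]
  have hcu := continuous_val u
  have hcu' := continuous_inv_val u
  have hu0 : ∀ x, star a' * ((u x : A) * a) = 0 := fun x => by rw [← mul_assoc, hu]
  have hu1 : ∀ x w, star a' * ((u x : A) * (a * w)) = 0 := fun x w => by
    rw [← mul_assoc (u x : A), ← mul_assoc, hu0, zero_mul]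
  have hui : ∀ x w, (((u x)⁻¹ : Aˣ) : A) * ((u x : A) * w) = w := fun x w => by
    rw [← mul_assoc, Units.inv_mul, one_mul]
  -- four shears
  obtain ⟨g1, hg1, hg1v⟩ := shear (K := K)
    (fun x => a' * star a * (((u x)⁻¹ : Aˣ) : A) * (1 - a' * star a')) (by fun_prop)
    (fun x => by
      simp only [mul_assoc, mul_sub, sub_mul, pb, mul_one, one_mul, sub_self, mul_zero, ha'])
  obtain ⟨g2, hg2, hg2v⟩ := shear (K := K)
    (fun x => - ((u x : A) * a * star a')) (by fun_prop)
    (fun x => by simp only [mul_assoc, neg_mul_neg, hu1, mul_zero])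
  obtain ⟨g3, hg3, hg3v⟩ := shear (K := K)
    (fun x => a * star a') (by fun_prop) (fun x => by simp only [mul_assoc, pba, mul_zero])
  obtain ⟨g4, hg4, hg4v⟩ := shear (K := K)
    (fun x => - (a' * star a)) (by fun_prop)
    (fun x => by simp only [mul_assoc, neg_mul_neg, pab, mul_zero])
  have s1 : ∀ x, ((g1 x : Aˣ) : A) * ((u x : A) * a) = (u x : A) * a + a' := by
    intro x
    simp only [(hg1v x).1, mul_assoc, mul_sub, sub_mul, add_mul, one_mul, mul_one, hu0, hui,
      mul_zero, sub_zero, ha]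
  have s2 : ∀ x, ((g2 x : Aˣ) : A) * ((u x : A) * a + a') = a' := by
    intro x
    simp only [(hg2v x).1, mul_assoc, mul_add, add_mul, one_mul, mul_one, neg_mul, hu0,
      mul_zero, ha']
    abel
  have s3 : ∀ x, ((g3 x : Aˣ) : A) * a' = a' + a := by
    intro x
    simp only [(hg3v x).1, mul_assoc, add_mul, one_mul, mul_one, ha']
  have s4 : ∀ x, ((g4 x : Aˣ) : A) * (a' + a) = a := by
    intro x
    simp only [(hg4v x).1, mul_assoc, mul_add, add_mul, one_mul, mul_one, neg_mul, haa',
      mul_zero, ha]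
    abel
  set u2 : C(K, Aˣ) := g4 * g3 * g2 * g1 * u with hu2
  have hu2a : ∀ x, (u2 x : A) * a = a := by
    intro x
    simp only [hu2, ContinuousMap.mul_apply, Units.val_mul, mul_assoc, s1, s2, s3, s4]
  have pu2a : ∀ x w, (u2 x : A) * (a * w) = a * w := fun x w => by
    rw [← mul_assoc, hu2a]
  have hcu2 := continuous_val u2
  obtain ⟨g5, hg5, hg5v⟩ := shear (K := K)
    (fun x => - (a * star a * (u2 x : A) * (1 - a * star a))) (by fun_prop)
    (fun x => by
      simp only [mul_assoc, mul_sub, sub_mul, neg_mul_neg, pa, mul_one, one_mul, sub_self,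
        mul_zero, hu2a, pu2a]
      )
  set u3 : C(K, Aˣ) := u2 * g5 with hu3
  have hu3a : ∀ x, (u3 x : A) * a = a := by
    intro x
    simp only [hu3, ContinuousMap.mul_apply, Units.val_mul, (hg5v x).1, mul_assoc, add_mul,
      neg_mul, sub_mul, one_mul, ha, mul_one, sub_self, mul_zero, neg_zero, add_zero, hu2a]
  have hau3 : ∀ x, star a * (u3 x : A) = star a := by
    intro x
    simp only [hu3, ContinuousMap.mul_apply, Units.val_mul, (hg5v x).1, mul_assoc, mul_add,
      mul_neg, mul_sub, one_mul, mul_one, pa, pu2a]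
    abel
  have hav : star (a * w) * (a * w) = 1 := by
    rw [star_mul, mul_assoc, ← mul_assoc (star a), ha, one_mul, hw]
  have pv : ∀ w, star v * (v * w) = w := fun w => by rw [← mul_assoc, hv, one_mul]
  have hj : star ((1 - a * star a) + a * v * star a) * ((1 - a * star a) + a * v * star a) = 1 := by
    simp only [star_add, star_sub, star_one, star_mul, star_star, mul_add, add_mul, mul_sub,
      sub_mul, mul_assoc, one_mul, mul_one, pa, pv]
    abel
  have e1 : u3 = amp _ hj u3 := by
    ext x
    have h1 : ∀ z, star a * ((u3 x : A) * z) = star a * z := fun z => by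
      rw [← mul_assoc, hau3]
    have h2 : ∀ z, (u3 x : A) * (a * z) = a * z := fun z => by rw [← mul_assoc, hu3a]
    rw [amp_val]
    simp only [star_add, star_sub, star_one, star_mul, star_star, mul_add, add_mul, mul_sub,
      sub_mul, mul_assoc, one_mul, mul_one, pa, hau3, h1, h2]
    abel
  have e2 : u3 ∈ Nul A K := by
    rw [← QuotientGroup.eq_one_iff, e1, amp_rot _ (a * w) hj hav, QuotientGroup.eq_one_iff]
    · exact swindle Ψ hΨ v w hv hw hvw hs a a' ha ha' haa hav u3
    · simp only [star_add, star_sub, star_one, star_mul, star_star, add_mul, 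
        sub_mul, mul_assoc, one_mul, mul_one, pa, hvw, sub_self, mul_zero, add_zero]
  have e3 : u2 ∈ Nul A K := (Subgroup.mul_mem_cancel_right _ hg5).1 e2
  exact (Subgroup.mul_mem_cancel_left _ (mul_mem (mul_mem (mul_mem hg4 hg3) hg2) hg1)).1 e3

/-- Kuiper type conclusion for compact families -/
lemma kuiper [CompactSpace K] (Ψ : A →ₙ+* A) (hΨ : Continuous Ψ) (v w : A) (hv : star v * v = 1)
    (hw : star w * w = 1) (hvw : star v * w = 0)
    (hs : ∀ x, Ψ x = w * x * star w + v * Ψ x * star v)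
    (hK : ∀ (B : Set A), B.Finite → ∀ δ : ℝ, 0 < δ → ∃ a a' : A, star a * a = 1 ∧
      star a' * a' = 1 ∧ star a' * a = 0 ∧ ∀ b ∈ B, ‖star a' * b * a‖ < δ)
    (u : C(K, Aˣ)) : u ∈ Nul A K := by
  have hcu := continuous_val u
  have hcu' := continuous_inv_val u
  obtain ⟨C, hC⟩ := (isCompact_range hcu'.norm).bddAbove
  have hC' : ∀ x, ‖(((u x)⁻¹ : Aˣ) : A)‖ ≤ C := fun x => hC ⟨x, rfl⟩
  rcases isEmpty_or_nonempty K with hE | ⟨⟨x0⟩⟩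
  · exact ⟨1, fun x => (hE.false x).elim, fun x => rfl⟩
  have hC0 : 0 ≤ C := (norm_nonneg _).trans (hC' x0)
  set δ : ℝ := 1 / (2 * (C + 1)) with hδ
  have hδ0 : 0 < δ := by positivity
  obtain ⟨B, hBf, hB⟩ :=
    Metric.totallyBounded_iff.1 (isCompact_range hcu).totallyBounded δ hδ0
  obtain ⟨a, a', ha, ha', haa, hab⟩ := hK B hBf δ hδ0
  have nrm : ∀ z : A, star z * z = 1 → ‖z‖ ≤ 1 := by
    intro z hz
    have h1 := CStarRing.norm_star_mul_self (x := z)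
    rw [hz] at h1
    rcases subsingleton_or_nontrivial A with h | h
    · rw [Subsingleton.elim z 0]; simp
    · rw [CStarRing.norm_one] at h1
      nlinarith [norm_nonneg z]
  have na := nrm a ha
  have na' := nrm a' ha'
  have hsm : ∀ x, ‖star a' * (u x : A) * a‖ < 2 * δ := by
    intro x
    obtain ⟨b, hb, hxb⟩ := Set.mem_iUnion₂.1 (hB ⟨x, rfl⟩)
    rw [Metric.mem_ball, dist_eq_norm] at hxb
    have e : star a' * (u x : A) * a = star a' * b * a + star a' * ((u x : A) - b) * a := by
      rw [mul_sub, sub_mul]; abel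
    rw [e]
    have h2 : ‖star a' * ((u x : A) - b) * a‖ ≤ ‖(u x : A) - b‖ := by
      calc ‖star a' * ((u x : A) - b) * a‖ ≤ ‖star a'‖ * ‖(u x : A) - b‖ * ‖a‖ := norm_mul₃_le
        _ ≤ 1 * ‖(u x : A) - b‖ * 1 := by rw [norm_star]; gcongr
        _ = _ := by ring
    linarith [norm_add_le (star a' * b * a) (star a' * ((u x : A) - b) * a), hab b hb]
  obtain ⟨g, hg, hgv⟩ := nearOne (K := K)
    (fun x => a' * (star a' * (u x : A) * a) * (star a * (((u x)⁻¹ : Aˣ) : A))) (by fun_prop)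
    (fun x => by
      calc _ ≤ ‖a'‖ * ‖star a' * (u x : A) * a‖ * ‖star a * (((u x)⁻¹ : Aˣ) : A)‖ := norm_mul₃_le
        _ ≤ 1 * (2 * δ) * (1 * C) := by
          gcongr
          · exact (hsm x).le
          · refine (norm_mul_le _ _).trans ?_
            rw [norm_star]
            gcongr
            exact hC' x
        _ < 1 := by
          rw [hδ]; field_simp; linarith)
  refine (Subgroup.mul_mem_cancel_left _ hg).1
    (kuiper1 Ψ hΨ v w hv hw hvw hs a a' ha ha' haa (g * u) fun x => ?_)
  have pa : ∀ w, star a * (a * w) = w := fun w => by rw [← mul_assoc, ha, one_mul]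
  have pb : ∀ w, star a' * (a' * w) = w := fun w => by rw [← mul_assoc, ha', one_mul]
  have hui : ∀ w, (((u x)⁻¹ : Aˣ) : A) * ((u x : A) * w) = w := fun w => by
    rw [← mul_assoc, Units.inv_mul, one_mul]
  simp only [ContinuousMap.mul_apply, Units.val_mul, hgv, sub_mul, mul_sub, mul_assoc, one_mul,
    pb, hui, ha, mul_one, sub_self]

end Htpy
end UOC

set_option linter.unusedSimpArgs false
set_option linter.unusedVariables false
namespace UOC
section VN
variable {H : Type*} [NormedAddCommGroup H] [InnerProductSpace ℂ H] [CompleteSpace H]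

lemma mem_of_comm (M : VonNeumannAlgebra H) (x : H →L[ℂ] H)
    (h : ∀ y ∈ M.commutant, y * x = x * y) : x ∈ M := by
  rw [← M.commutant_commutant, VonNeumannAlgebra.mem_commutant_iff]
  exact h

lemma comm_of_mem {M : VonNeumannAlgebra H} {x y : H →L[ℂ] H} (hx : x ∈ M)
    (hy : y ∈ M.commutant) : x * y = y * x :=
  VonNeumannAlgebra.mem_commutant_iff.1 hy x hx

lemma smul_mem' {M : VonNeumannAlgebra H} {x : H →L[ℂ] H} (hx : x ∈ M) (c : ℂ) : c • x ∈ M :=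
  M.toStarSubalgebra.smul_mem hx c

lemma rsmul_mem' {M : VonNeumannAlgebra H} {x : H →L[ℂ] H} (hx : x ∈ M) (c : ℝ) : c • x ∈ M := by
  have := smul_mem' hx (c : ℂ)
  simpa using this

lemma inner_star (x : H →L[ℂ] H) (g h : H) : inner ℂ (x g) h = inner ℂ g (star x h) := by
  rw [ContinuousLinearMap.star_eq_adjoint, ContinuousLinearMap.adjoint_inner_right]

lemma proj_norm {e : H →L[ℂ] H} (he : e * e = e) (hs : star e = e) (h : H) : ‖e h‖ ≤ ‖h‖ := by
  have h1 : inner ℂ (e h) (e h) = inner ℂ h (e h) := by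
    rw [inner_star, hs]
    change inner ℂ h ((e * e) h) = _
    rw [he]
  have h2 : ‖e h‖ ^ 2 ≤ ‖h‖ * ‖e h‖ := by
    rw [← inner_self_eq_norm_sq (𝕜 := ℂ), h1]
    exact (RCLike.re_le_norm _).trans (norm_inner_le_norm _ _)
  nlinarith [norm_nonneg (e h), norm_nonneg h]

lemma sum_mem_vn {ι : Type*} (M : VonNeumannAlgebra H) (x e : ι → H →L[ℂ] H) (C : ℝ) (hC : 0 ≤ C)
    (hx : ∀ i, x i ∈ M) (hn : ∀ i, ‖x i‖ ≤ C) (he : ∀ i, e i * e i = e i)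
    (hes : ∀ i, star (e i) = e i) (heo : ∀ i j, i ≠ j → e i * e j = 0)
    (hxe : ∀ i, x i * e i = x i) (hxo : ∀ i j, i ≠ j → star (x i) * x j = 0) :
    ∃ X ∈ M, ‖X‖ ≤ C ∧ ∀ h, HasSum (fun i => x i h) (X h) := by
  classical
  have hV : OrthogonalFamily ℂ (fun i => (x i).range) fun i => ((x i).range).subtypeₗᵢ := by
    refine OrthogonalFamily.of_pairwise ?_
    intro i j hij
    rw [Function.onFun, Submodule.isOrtho_iff_inner_eq]
    rintro _ ⟨a, rfl⟩ _ ⟨b, rfl⟩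
    change inner ℂ (x i a) (x j b) = 0
    rw [inner_star]
    change inner ℂ a ((star (x i) * x j) b) = 0
    rw [hxo i j hij]; simp
  have hpy : ∀ (s : Finset ι) (h : H), ‖∑ i ∈ s, x i h‖ ^ 2 = ∑ i ∈ s, ‖x i h‖ ^ 2 := by
    intro s h
    have := hV.norm_sum (fun i => ⟨x i h, ⟨h, rfl⟩⟩) s
    simpa using this
  have hEs : ∀ (s : Finset ι) (h : H), ∑ i ∈ s, ‖e i h‖ ^ 2 ≤ ‖h‖ ^ 2 := by
    intro s h
    have h1 : (∑ i ∈ s, e i) * (∑ i ∈ s, e i) = ∑ i ∈ s, e i := by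
      rw [Finset.sum_mul]
      refine Finset.sum_congr rfl fun i hi => ?_
      rw [Finset.mul_sum, Finset.sum_eq_single i, he]
      · intro j _ hj; exact heo i j hj.symm
      · intro h; exact (h hi).elim
    have h2 : star (∑ i ∈ s, e i) = ∑ i ∈ s, e i := by
      rw [star_sum]; exact Finset.sum_congr rfl fun i _ => hes i
    have h3 := proj_norm h1 h2 h
    have h4 : ∑ i ∈ s, ‖e i h‖ ^ 2 = RCLike.re (inner ℂ h ((∑ i ∈ s, e i) h)) := by
      rw [sum_apply, inner_sum, map_sum]
      refine Finset.sum_congr rfl fun i _ => ?_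
      rw [← inner_self_eq_norm_sq (𝕜 := ℂ), inner_star, hes]
      change RCLike.re (inner ℂ h ((e i * e i) h)) = _
      rw [he]
    rw [h4]
    calc _ ≤ ‖h‖ * ‖(∑ i ∈ s, e i) h‖ := (RCLike.re_le_norm _).trans (norm_inner_le_norm _ _)
      _ ≤ ‖h‖ * ‖h‖ := by gcongr
      _ = _ := by ring
  have hb : ∀ (s : Finset ι) (h : H), ∑ i ∈ s, ‖x i h‖ ^ 2 ≤ (C * ‖h‖) ^ 2 := by
    intro s h
    calc ∑ i ∈ s, ‖x i h‖ ^ 2 ≤ ∑ i ∈ s, C ^ 2 * ‖e i h‖ ^ 2 := by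
          refine Finset.sum_le_sum fun i _ => ?_
          rw [← mul_pow]
          gcongr
          have : x i h = x i (e i h) := by
            conv_lhs => rw [← hxe i]
            rfl
          rw [this]
          exact (x i).le_of_opNorm_le (hn i) _
      _ = C ^ 2 * ∑ i ∈ s, ‖e i h‖ ^ 2 := by rw [Finset.mul_sum]
      _ ≤ C ^ 2 * ‖h‖ ^ 2 := by gcongr; exact hEs s h
      _ = _ := by ring
  have hsum : ∀ h, Summable fun i => x i h := by
    intro h
    have := (hV.summable_iff_norm_sq_summable (fun i => ⟨x i h, ⟨h, rfl⟩⟩)).2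
      (summable_of_sum_le (fun i => by positivity) (c := (C * ‖h‖) ^ 2) (fun s => by simpa using hb s h))
    simpa using this
  let X : H →L[ℂ] H := LinearMap.mkContinuous
    { toFun := fun h => ∑' i, x i h
      map_add' := fun a b => by
        simp only [map_add]; exact (hsum a).tsum_add (hsum b)
      map_smul' := fun c a => by
        simp only [map_smul]; exact (hsum a).tsum_const_smul c } C (by
      intro h
      refine le_of_tendsto (hsum h).hasSum.norm (Filter.Eventually.of_forall fun s => ?_)
      refine le_of_sq_le_sq ?_ (by positivity)
      rw [hpy]; exact hb s h)
  have hX : ∀ h, HasSum (fun i => x i h) (X h) := fun h => (hsum h).hasSum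
  refine ⟨X, ?_, LinearMap.mkContinuous_norm_le _ hC _, hX⟩
  refine mem_of_comm M X fun y hy => ?_
  ext h
  refine (HasSum.mapL y (hX h)).unique ?_
  have e : (fun i => y (x i h)) = fun i => x i (y h) := by
    ext i
    exact (congrArg (fun z : H →L[ℂ] H => z h) (comm_of_mem (hx i) hy)).symm
  rw [e]
  exact hX (y h)

/-- The infinite amplification. -/
lemma exists_psi (M : VonNeumannAlgebra H) (v w : H →L[ℂ] H) (hvM : v ∈ M) (hwM : w ∈ M)
    (hv : star v * v = 1) (hw : star w * w = 1) (hvw : star v * w = 0) :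
    ∃ Ψ : (H →L[ℂ] H) → (H →L[ℂ] H), (∀ x ∈ M, Ψ x ∈ M) ∧ (∀ x ∈ M, ‖Ψ x‖ ≤ ‖x‖) ∧
      (∀ x ∈ M, ∀ y ∈ M, Ψ (x + y) = Ψ x + Ψ y) ∧ (∀ x ∈ M, ∀ y ∈ M, Ψ (x * y) = Ψ x * Ψ y) ∧
      ∀ x ∈ M, Ψ x = w * x * star w + v * Ψ x * star v := by
  classical
  have hwv : star w * v = 0 := by
    have := congrArg star hvw
    simpa using this
  let s : ℕ → H →L[ℂ] H := fun n => v ^ n * w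
  have hsM : ∀ n, s n ∈ M := fun n => mul_mem (pow_mem hvM n) hwM
  have hvn : ∀ n z, star (v ^ n) * (v ^ n * z) = z := by
    intro n
    induction n with
    | zero => intro z; simp
    | succ n ih =>
      intro z
      rw [pow_succ, star_mul, mul_assoc, mul_assoc, ih, ← mul_assoc, hv, one_mul]
  have hs1 : ∀ n, star (s n) * s n = 1 := by
    intro n
    simp only [s, star_mul, mul_assoc, hvn, hw]
  have hlt : ∀ n k, star (s n) * s (n + (k + 1)) = 0 := by
    intro n k
    simp only [s, star_mul, mul_assoc, pow_add v n, hvn]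
    rw [pow_succ', mul_assoc, ← mul_assoc, hwv, zero_mul]
  have hs0 : ∀ n m, n ≠ m → star (s n) * s m = 0 := by
    intro n m hnm
    rcases lt_or_gt_of_ne hnm with h | h
    · obtain ⟨k, rfl⟩ := Nat.exists_eq_add_of_lt h
      exact hlt n k
    · obtain ⟨k, rfl⟩ := Nat.exists_eq_add_of_lt h
      have := congrArg star (hlt m k)
      rw [star_mul, star_star, star_zero] at this
      exact this
  have hs0' : ∀ n m, n ≠ m → ∀ z, star (s n) * (s m * z) = 0 := fun n m h z => by
    rw [← mul_assoc, hs0 n m h, zero_mul]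
  have hs1' : ∀ n z, star (s n) * (s n * z) = z := fun n z => by
    rw [← mul_assoc, hs1, one_mul]
  have nrm : ∀ z : H →L[ℂ] H, star z * z = 1 → ‖z‖ ≤ 1 := by
    intro z hz
    have h1 := CStarRing.norm_star_mul_self (x := z)
    rw [hz] at h1
    have h2 : ‖(1 : H →L[ℂ] H)‖ ≤ 1 := ContinuousLinearMap.norm_id_le
    nlinarith [norm_nonneg z]
  have main : ∀ x : H →L[ℂ] H, ∃ X : H →L[ℂ] H, x ∈ M → X ∈ M ∧ ‖X‖ ≤ ‖x‖ ∧
      ∀ h, HasSum (fun n => (s n * x * star (s n)) h) (X h) := by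
    intro x
    by_cases hx : x ∈ M
    · obtain ⟨X, h1, h2, h3⟩ := sum_mem_vn M (fun n => s n * x * star (s n))
        (fun n => s n * star (s n)) ‖x‖ (norm_nonneg _)
        (fun n => mul_mem (mul_mem (hsM n) hx) (star_mem (hsM n)))
        (fun n => by
          calc _ ≤ ‖s n‖ * ‖x‖ * ‖star (s n)‖ := norm_mul₃_le
            _ ≤ 1 * ‖x‖ * 1 := by
              rw [norm_star]
              have := nrm _ (hs1 n)
              gcongr
            _ = _ := by ring)
        (fun n => by simp only [mul_assoc, hs1'])
        (fun n => by simp)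
        (fun i j hij => by simp only [mul_assoc, hs0' i j hij, mul_zero])
        (fun n => by simp only [mul_assoc, hs1'])
        (fun i j hij => by simp only [star_mul, star_star, mul_assoc, hs0' i j hij, mul_zero])
      exact ⟨X, fun _ => ⟨h1, h2, h3⟩⟩
    · exact ⟨0, fun h => (hx h).elim⟩
  choose Ψ hΨ using main
  have hS : ∀ x ∈ M, ∀ h, HasSum (fun n => (s n * x * star (s n)) h) (Ψ x h) :=
    fun x hx => (hΨ x hx).2.2
  refine ⟨Ψ, fun x hx => (hΨ x hx).1, fun x hx => (hΨ x hx).2.1, ?_, ?_, ?_⟩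
  · intro x hx y hy
    ext h
    refine (hS (x + y) (add_mem hx hy) h).unique ?_
    have := (hS x hx h).add (hS y hy h)
    refine this.congr_fun ?_
    intro n
    simp [mul_add, add_mul]
  · intro x hx y hy
    ext h
    refine (hS (x * y) (mul_mem hx hy) h).unique ?_
    have h1 : ∀ n, star (s n) (Ψ y h) = (y * star (s n)) h := by
      intro n
      refine (HasSum.mapL (star (s n)) (hS y hy h)).unique ?_
      have := hasSum_ite_eq n ((y * star (s n)) h)
      refine this.congr_fun ?_
      intro m
      split_ifs with hm
      · subst hm
        change (star (s m) * (s m * y * star (s m))) h = _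
        simp only [mul_assoc, hs1']
      · change (star (s n) * (s m * y * star (s m))) h = _
        simp only [mul_assoc, hs0' n m (Ne.symm hm)]
        simp
    have := hS x hx (Ψ y h)
    refine this.congr_fun ?_
    intro n
    change _ = s n (x (star (s n) (Ψ y h)))
    rw [h1]
    rfl
  · intro x hx
    ext h
    refine (hS x hx h).unique ?_
    rw [← hasSum_nat_add_iff' 1]
    have := HasSum.mapL v (hS x hx (star v h))
    simp only [Finset.range_one, Finset.sum_singleton]
    have e : (w * x * star w + v * Ψ x * star v) h - (s 0 * x * star (s 0)) h
        = v (Ψ x (star v h)) := by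
      simp [s]
    rw [e]
    refine this.congr_fun ?_
    intro n
    change (s (n + 1) * x * star (s (n+1))) h = (v * (s n * x * star (s n)) * star v) h
    simp only [s, pow_succ', star_mul, mul_assoc]

end VN
end UOC

set_option linter.unusedSimpArgs false
set_option linter.unusedVariables false
namespace UOC
section VN
variable {H : Type*} [NormedAddCommGroup H] [InnerProductSpace ℂ H] [CompleteSpace H]

/-- the range projection of a subspace invariant under the commutant -/
lemma exists_range_proj (M : VonNeumannAlgebra H) (U : Submodule ℂ H)
    (hU : ∀ y ∈ M.commutant, ∀ h ∈ U, y h ∈ U) :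
    ∃ f ∈ M, f * f = f ∧ star f = f ∧ f = U.topologicalClosure.starProjection ∧
      (∀ h ∈ U, f h = h) ∧ ∀ y : H →L[ℂ] H, (∀ h ∈ U, y h = 0) → y * f = 0 := by
  let R := U.topologicalClosure
  have hR : IsClosed (R : Set H) := U.isClosed_topologicalClosure
  have : CompleteSpace R := hR.completeSpace_coe
  have hp : IsStarProjection R.starProjection := isStarProjection_starProjection
  refine ⟨R.starProjection, ?_, hp.isIdempotentElem, hp.isSelfAdjoint, rfl, ?_, ?_⟩
  · rw [VonNeumannAlgebra.IsStarProjection.mem_iff hp]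
    intro y hy
    have h1 : R.starProjection.range = R := Submodule.range_starProjection R
    rw [h1]
    intro h hh
    change y h ∈ closure (U : Set H)
    exact map_mem_closure y.continuous hh (fun z hz => hU y hy z hz)
  · intro h hh
    exact Submodule.starProjection_eq_self_iff.2 (U.le_topologicalClosure hh)
  · intro y hy
    ext h
    have h1 : R.starProjection h ∈ closure (U : Set H) := Submodule.starProjection_apply_mem R h
    have h2 : IsClosed {z : H | y z = 0} := isClosed_eq y.continuous continuous_const
    exact closure_minimal (s := (U : Set H)) (fun z hz => hy z hz) h2 h1

lemma mul_eq_zero_of_star {x : H →L[ℂ] H} (h : star x * x = 0) : x = 0 :=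
  CStarRing.star_mul_self_eq_zero_iff x |>.1 h

/-- polar decomposition -/
lemma polar (M : VonNeumannAlgebra H) (x : H →L[ℂ] H) (hx : x ∈ M) :
    ∃ w ∈ M, w * star w * w = w ∧ x * (star w * w) = x ∧ (w * star w) * x = x ∧
      (∀ y, x * y = 0 → w * y = 0) ∧ (∀ y, y * x = 0 → y * w = 0) := by
  let a := CFC.abs x
  have has : star a = a := (CFC.abs_nonneg x).isSelfAdjoint
  have haa : a * a = star x * x := CFC.abs_mul_abs x
  have haM : ∀ y ∈ M.commutant, y * a = a * y := by
    intro y hy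
    exact Commute.cfcAbs_right (comm_of_mem hx hy) (comm_of_mem hx (star_mem hy))
  have hnorm : ∀ h, ‖x h‖ = ‖a h‖ := by
    intro h
    have : ‖x h‖ ^ 2 = ‖a h‖ ^ 2 := by
      rw [← inner_self_eq_norm_sq (𝕜 := ℂ), ← inner_self_eq_norm_sq (𝕜 := ℂ), inner_star,
        inner_star, has]
      change RCLike.re (inner ℂ h ((star x * x) h)) = RCLike.re (inner ℂ h ((a * a) h))
      rw [haa]
    exact (sq_eq_sq₀ (norm_nonneg _) (norm_nonneg _)).1 this
  obtain ⟨e, heM, hee, hes, heR, heU, he0⟩ := exists_range_proj M a.range (by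
    rintro y hy _ ⟨h, rfl⟩
    exact ⟨y h, (congrArg (fun z : H →L[ℂ] H => z h) (haM y hy)).symm⟩)
  have hea : e * a = a := by
    ext h; exact heU _ ⟨h, rfl⟩
  have he0' : ∀ y : H →L[ℂ] H, y * a = 0 → y * e = 0 := by
    intro y hy
    refine he0 y ?_
    rintro _ ⟨h, rfl⟩
    exact congrArg (fun z : H →L[ℂ] H => z h) hy
  let R := a.range.topologicalClosure
  have : CompleteSpace R := a.range.isClosed_topologicalClosure.completeSpace_coe
  let ea : H →ₗ[ℂ] R := LinearMap.codRestrict R a.toLinearMap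
    (fun h => a.range.le_topologicalClosure ⟨h, rfl⟩)
  have hd : DenseRange ea := by
    intro z
    rw [closure_subtype]
    have h1 : (Subtype.val '' Set.range ea) = (a.range : Set H) := by
      ext t; constructor
      · rintro ⟨_, ⟨h, rfl⟩, rfl⟩; exact ⟨h, rfl⟩
      · rintro ⟨h, rfl⟩; exact ⟨ea h, ⟨h, rfl⟩, rfl⟩
    rw [h1]; exact z.2
  let w0 : R →L[ℂ] H := x.toLinearMap.extendOfNorm ea
  have hw0 : ∀ h, w0 (ea h) = x h := fun h =>
    LinearMap.extendOfNorm_eq hd ⟨1, fun h => by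
      rw [one_mul]; exact (hnorm h).le⟩ h
  have hw0n : ∀ r : R, ‖w0 r‖ = ‖r‖ := by
    intro r
    refine hd.induction_on (p := fun r => ‖w0 r‖ = ‖r‖) r (isClosed_eq (by fun_prop) (by fun_prop)) ?_
    intro h
    rw [hw0]; exact hnorm h
  let w : H →L[ℂ] H := w0.comp R.orthogonalProjectionOnto
  have hwa : w * a = x := by
    ext h
    have h1 : R.orthogonalProjectionOnto (a h) = ea h :=
      Submodule.orthogonalProjectionOnto_mem_subspace_eq_self (ea h)
    change w0 (R.orthogonalProjectionOnto (a h)) = x h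
    rw [h1, hw0]
  have hproj_eq : ∀ h, e h = (R.orthogonalProjectionOnto h : H) := fun h => by rw [heR]; rfl
  have hwn : ∀ h, ‖w h‖ = ‖e h‖ := by
    intro h
    change ‖w0 (R.orthogonalProjectionOnto h)‖ = _
    rw [hw0n, hproj_eq]; rfl
  have hww : star w * w = e := by
    refine ContinuousLinearMap.ext fun h => ?_
    have : (star w * w).toLinearMap = e.toLinearMap := by
      rw [← sub_eq_zero, ← inner_map_self_eq_zero]
      intro h
      rw [LinearMap.sub_apply, inner_sub_left, sub_eq_zero]
      change inner ℂ (star w (w h)) h = inner ℂ (e h) h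
      have h1 : inner ℂ (e h) h = inner ℂ (e h) (e h) := by
        conv_lhs => rw [← hee]
        change inner ℂ (e (e h)) h = _
        rw [inner_star, hes]
      rw [inner_star, star_star, h1, inner_self_eq_norm_sq_to_K, hwn, inner_self_eq_norm_sq_to_K]
    exact congrArg (fun z : H →ₗ[ℂ] H => z h) this
  have hwe : w * e = w := by
    ext h
    have h1 : R.orthogonalProjectionOnto (e h) = R.orthogonalProjectionOnto h := by
      rw [hproj_eq]
      exact Submodule.orthogonalProjectionOnto_mem_subspace_eq_self _
    change w0 (R.orthogonalProjectionOnto (e h)) = w0 _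
    rw [h1]; rfl
  have hwM : w ∈ M := by
    refine mem_of_comm M w fun y hy => ?_
    have h1 : (w * y - y * w) * a = 0 := by
      rw [sub_mul, mul_assoc, haM y hy, ← mul_assoc, hwa, mul_assoc, hwa, comm_of_mem hx hy,
        sub_self]
    have h2 := he0' _ h1
    rw [sub_mul, mul_assoc, mul_assoc, hwe, ← comm_of_mem heM hy, ← mul_assoc, hwe,
      sub_eq_zero] at h2
    exact h2.symm
  have hae : a * e = a := by
    have := congrArg star hea
    simpa [has, hes] using this
  refine ⟨w, hwM, ?_, ?_, ?_, ?_, ?_⟩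
  · rw [mul_assoc, hww, hwe]
  · rw [hww, ← hwa, mul_assoc, hae]
  · rw [← hwa, mul_assoc w, ← mul_assoc (star w), hww, hea]
  · intro y hy
    have h1 : a * y = 0 := by
      refine mul_eq_zero_of_star ?_
      rw [star_mul, has, mul_assoc, ← mul_assoc a, haa, mul_assoc, hy]; simp
    have h2 := he0' (star y) (by simpa [has] using congrArg star h1)
    have h3 : e * y = 0 := by simpa [hes] using congrArg star h2
    rw [← hwe, mul_assoc, h3, mul_zero]
  · intro y hy
    rw [← hwa, ← mul_assoc] at hy
    rw [← hwe, ← mul_assoc]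
    exact he0' _ hy

end VN
end UOC

set_option linter.unusedSimpArgs false
set_option linter.unusedVariables false
namespace UOC
section VN
variable {H : Type*} [NormedAddCommGroup H] [InnerProductSpace ℂ H] [CompleteSpace H]

lemma piso_norm {x : H →L[ℂ] H} (hx : x * star x * x = x) : ‖x‖ ≤ 1 := by
  have h1 : ‖star x * x‖ = ‖x‖ * ‖x‖ := CStarRing.norm_star_mul_self
  have h2 : ‖star (star x * x) * (star x * x)‖ = ‖star x * x‖ * ‖star x * x‖ :=
    CStarRing.norm_star_mul_self
  have h3 : star (star x * x) * (star x * x) = star x * x := by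
    rw [star_mul, star_star, mul_assoc, ← mul_assoc x, hx]
  rw [h3, h1] at h2
  by_contra h
  push Not at h
  have h4 : 1 < ‖x‖ * ‖x‖ := by nlinarith
  nlinarith

/-- central support -/
lemma central_cover (M : VonNeumannAlgebra H) (r r' : H →L[ℂ] H) (hr : r ∈ M) (hr' : r' ∈ M)
    (hrr : ∀ y ∈ M, r' * y * r = 0) :
    ∃ f ∈ M, f * f = f ∧ star f = f ∧ (∀ y ∈ M, f * y = y * f) ∧ f * r = r ∧ r' * f = 0 := by
  let S : Set H := {k | ∃ y ∈ M, ∃ h, k = y (r h)}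
  obtain ⟨f, hfM, hff, hfs, -, hfU, hf0⟩ := exists_range_proj M (Submodule.span ℂ S) (by
    intro y hy h hh
    have : Submodule.span ℂ S ≤ (Submodule.span ℂ S).comap y.toLinearMap := by
      rw [Submodule.span_le]
      rintro _ ⟨m, hm, h, rfl⟩
      refine Submodule.subset_span ⟨m, hm, y h, ?_⟩
      change (y * (m * r)) h = (m * r * y) h
      rw [comm_of_mem (mul_mem hm hr) hy]
    exact this hh)
  have hf0' : ∀ y : H →L[ℂ] H, (∀ m ∈ M, y * m * r = 0) → y * f = 0 := by
    intro y hy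
    refine hf0 y fun h hh => ?_
    have : Submodule.span ℂ S ≤ LinearMap.ker y.toLinearMap := by
      rw [Submodule.span_le]
      rintro _ ⟨m, hm, h, rfl⟩
      change (y * m * r) h = 0
      rw [hy m hm]; rfl
    exact this hh
  have hfm : ∀ m ∈ M, f * (m * r) = m * r := by
    intro m hm
    ext h
    exact hfU _ (Submodule.subset_span ⟨m, hm, h, rfl⟩)
  have h1 : ∀ m ∈ M, f * m * f = m * f := by
    intro m hm
    have := hf0' ((1 - f) * m) (by
      intro y hy
      rw [mul_assoc, mul_assoc, ← mul_assoc m, sub_mul, hfm _ (mul_mem hm hy), one_mul, sub_self])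
    rw [sub_mul, sub_mul, one_mul, sub_eq_zero] at this
    exact this.symm
  refine ⟨f, hfM, hff, hfs, fun y hy => ?_, ?_, ?_⟩
  · have h2 := congrArg star (h1 (star y) (star_mem hy))
    simp only [star_mul, star_star, hfs] at h2
    rw [← h2, ← mul_assoc, h1 y hy]
  · have := hfm 1 (one_mem M)
    simpa using this
  · refine hf0' r' fun m hm => hrr m hm

/-- comparison of projections -/
lemma compare (M : VonNeumannAlgebra H) (b d : H →L[ℂ] H) (hb : b ∈ M) (hd : d ∈ M)
    (hbb : b * b = b) (hbs : star b = b) (hdd : d * d = d) (hds : star d = d) :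
    ∃ w ∈ M, ∃ z ∈ M, z * z = z ∧ star z = z ∧ (∀ y ∈ M, z * y = y * z) ∧
      w * b = w ∧ d * w = w ∧ w * star w * w = w ∧ z * (b - star w * w) = 0 ∧
      (1 - z) * (d - w * star w) = 0 := by
  classical
  let P : Set (Set (H →L[ℂ] H)) := {S | (∀ x ∈ S, x ∈ M ∧ x * star x * x = x ∧ x ≠ 0 ∧ x * b = x ∧
    d * x = x) ∧ ∀ x ∈ S, ∀ y ∈ S, x ≠ y → star x * y = 0 ∧ x * star y = 0}
  obtain ⟨S, hS⟩ := zorn_subset P (by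
    intro c hc hch
    refine ⟨⋃₀ c, ⟨?_, ?_⟩, fun s hs => Set.subset_sUnion_of_mem hs⟩
    · rintro x ⟨s, hs, hx⟩
      exact (hc hs).1 x hx
    · rintro x ⟨s, hs, hx⟩ y ⟨t, ht, hy⟩ hxy
      rcases hch.total hs ht with h | h
      · exact (hc ht).2 x (h hx) y hy hxy
      · exact (hc hs).2 x hx y (h hy) hxy)
  have hS1 : ∀ i : S, (i : H →L[ℂ] H) ∈ M ∧ (i : H →L[ℂ] H) * star (i : H →L[ℂ] H) * i = i ∧
    (i : H →L[ℂ] H) ≠ 0 ∧ (i : H →L[ℂ] H) * b = i ∧ d * (i : H →L[ℂ] H) = i :=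
    fun i => hS.prop.1 i i.2
  have hS2 : ∀ i j : S, i ≠ j → star (i : H →L[ℂ] H) * j = 0 ∧ (i : H →L[ℂ] H) * star (j : H →L[ℂ] H) = 0 :=
    fun i j hij => hS.prop.2 i i.2 j j.2 (fun h => hij (Subtype.ext h))
  obtain ⟨X, hXM, -, hX⟩ := sum_mem_vn M (fun i : S => (i : H →L[ℂ] H))
    (fun i => star (i : H →L[ℂ] H) * i) 1 zero_le_one (fun i => (hS1 i).1)
    (fun i => piso_norm (hS1 i).2.1)
    (fun i => by rw [mul_assoc, ← mul_assoc (i : H →L[ℂ] H), (hS1 i).2.1])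
    (fun i => by simp)
    (fun i j hij => by
      rw [mul_assoc, ← mul_assoc (i : H →L[ℂ] H), (hS2 i j hij).2]; simp)
    (fun i => by rw [← mul_assoc, (hS1 i).2.1])
    (fun i j hij => (hS2 i j hij).1)
  have single : ∀ (i : S) (f : S → H), (∀ j, j ≠ i → f j = 0) → HasSum f (f i) :=
    fun i f hf => hasSum_single i hf
  -- X xᵢ* = xᵢ xᵢ*
  have hX1 : ∀ i : S, X * star (i : H →L[ℂ] H) = i * star (i : H →L[ℂ] H) := by
    intro i
    ext h
    refine (hX _).unique ?_
    refine single i (fun j : S => (j : H →L[ℂ] H) (star (i : H →L[ℂ] H) h)) fun j hj => ?_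
    exact congrArg (fun z : H →L[ℂ] H => z h) (hS2 j i hj).2
  have hX2 : ∀ i : S, star (i : H →L[ℂ] H) * X = star (i : H →L[ℂ] H) * i := by
    intro i
    ext h
    refine (HasSum.mapL (star (i : H →L[ℂ] H)) (hX h)).unique ?_
    refine single i (fun j : S => star (i : H →L[ℂ] H) ((j : H →L[ℂ] H) h)) fun j hj => ?_
    exact congrArg (fun z : H →L[ℂ] H => z h) (hS2 i j (Ne.symm hj)).1
  have hX3 : ∀ i : S, star X * (i : H →L[ℂ] H) = star (i : H →L[ℂ] H) * i := by
    intro i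
    simpa using congrArg star (hX2 i)
  have hX4 : ∀ i : S, (i : H →L[ℂ] H) * star X = i * star (i : H →L[ℂ] H) := by
    intro i
    simpa using congrArg star (hX1 i)
  have hXXX : X * star X * X = X := by
    ext h
    refine HasSum.unique ?_ (hX h)
    have := HasSum.mapL (X * star X) (hX h)
    refine this.congr_fun fun i => ?_
    change (i : H →L[ℂ] H) h = ((X * star X) * i) h
    rw [mul_assoc, hX3, ← mul_assoc, hX1, (hS1 i).2.1]
  have hXb : X * b = X := by
    ext h
    refine (hX (b h)).unique ?_
    refine (hX h).congr_fun fun i => ?_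
    exact congrArg (fun z : H →L[ℂ] H => z h) (hS1 i).2.2.2.1
  have hdX : d * X = X := by
    ext h
    refine (HasSum.mapL d (hX h)).unique ?_
    refine (hX h).congr_fun fun i => ?_
    exact congrArg (fun z : H →L[ℂ] H => z h) (hS1 i).2.2.2.2
  have hbX : b * star X = star X := by simpa [hbs] using congrArg star hXb
  have hXd : star X * d = star X := by simpa [hds] using congrArg star hdX
  set r := b - star X * X with hr
  set r' := d - X * star X with hr'
  have hrM : r ∈ M := sub_mem hb (mul_mem (star_mem hXM) hXM)
  have hrM' : r' ∈ M := sub_mem hd (mul_mem hXM (star_mem hXM))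
  have hXXX' : ∀ y, X * (star X * (X * y)) = X * y := fun y => by
    rw [← mul_assoc, ← mul_assoc, hXXX]
  have hsXXX : star X * (X * star X) = star X := by
    have := congrArg star hXXX
    simpa [mul_assoc] using this
  have hrb : r * b = r := by rw [hr, sub_mul, hbb, mul_assoc, hXb]
  have hdr' : d * r' = r' := by rw [hr', mul_sub, hdd, ← mul_assoc, hdX]
  have hrs : star r = r := by simp [hr, hbs]
  have hrs' : star r' = r' := by simp [hr', hds]
  have hXr : X * r = 0 := by
    rw [hr, mul_sub, hXb, ← mul_assoc, hXXX, sub_self]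
  have hrr : r * r = r := by
    conv_lhs => enter [1]; rw [hr]
    rw [sub_mul, mul_assoc, hXr, mul_zero, sub_zero]
    have := congrArg star hrb
    simpa [hbs, hrs] using this
  have hr'X : r' * X = 0 := by
    rw [hr', sub_mul, hdX, hXXX, sub_self]
  have hrr' : r' * r' = r' := by
    conv_lhs => enter [2]; rw [hr']
    rw [mul_sub, ← mul_assoc, hr'X, zero_mul, sub_zero]
    have := congrArg star hdr'
    simpa [hds, hrs'] using this
  have hir : ∀ i : S, (i : H →L[ℂ] H) * r = 0 := by
    intro i
    rw [hr, mul_sub, (hS1 i).2.2.2.1, ← mul_assoc, hX4, mul_assoc, hX2, ← mul_assoc, (hS1 i).2.1,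
      sub_self]
  have hr'i : ∀ i : S, r' * (i : H →L[ℂ] H) = 0 := by
    intro i
    rw [hr', sub_mul, (hS1 i).2.2.2.2, mul_assoc, hX3, ← mul_assoc, hX1, (hS1 i).2.1,
      sub_self]
  have key : ∀ y ∈ M, r' * y * r = 0 := by
    intro y hy
    by_contra hne
    obtain ⟨w, hwM, hw1, hw2, hw3, hw4, hw5⟩ := polar M (r' * y * r)
      (mul_mem (mul_mem hrM' hy) hrM)
    have hw0 : w ≠ 0 := by
      rintro rfl
      apply hne
      rw [← hw3]; simp
    have hwr : w * r = w := by
      have := hw4 (1 - r) (by rw [mul_sub, mul_one, mul_assoc _ r r, hrr, sub_self])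
      rw [mul_sub, mul_one, sub_eq_zero] at this
      exact this.symm
    have hrw : r' * w = w := by
      have := hw5 (1 - r') (by
        rw [sub_mul, one_mul, ← mul_assoc, ← mul_assoc, hrr', sub_self])
      rw [sub_mul, one_mul, sub_eq_zero] at this
      exact this.symm
    have hor : ∀ x ∈ S, star x * w = 0 ∧ x * star w = 0 := by
      intro x hx
      constructor
      · have h1 := congrArg star (hr'i ⟨x, hx⟩)
        rw [star_mul, hrs', star_zero] at h1
        rw [← hrw, ← mul_assoc, h1, zero_mul]
      · have h1 := hir ⟨x, hx⟩
        have h2 : star w = r * star w := by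
          have := congrArg star hwr
          rw [star_mul, hrs] at this
          exact this.symm
        rw [h2, ← mul_assoc]
        change (x * r) * star w = 0
        rw [h1, zero_mul]
    have hor' : ∀ x ∈ S, star w * x = 0 ∧ w * star x = 0 := by
      intro x hx
      have := hor x hx
      constructor
      · simpa using congrArg star this.1
      · simpa using congrArg star this.2
    have hins : insert w S ∈ P := by
      refine ⟨?_, ?_⟩
      · rintro x (rfl | hx)
        · refine ⟨hwM, hw1, hw0, ?_, ?_⟩
          · rw [← hwr, mul_assoc, hrb]
          · rw [← hrw, ← mul_assoc, hdr']
        · exact hS.prop.1 x hx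
      · rintro x (rfl | hx) y (rfl | hy) hxy
        · exact (hxy rfl).elim
        · exact hor' y hy
        · exact hor x hx
        · exact hS.prop.2 x hx y hy hxy
    have hwS : w ∈ S := hS.le_of_ge hins (Set.subset_insert w S) (Set.mem_insert w S)
    apply hw0
    rw [← hwr]
    exact hir ⟨w, hwS⟩
  obtain ⟨f, hfM, hff, hfs, hfc, hfr, hrf⟩ := central_cover M r r' hrM hrM' key
  refine ⟨X, hXM, 1 - f, sub_mem (one_mem M) hfM, ?_, ?_, ?_, hXb, hdX, hXXX, ?_, ?_⟩
  · simp [mul_sub, sub_mul, hff]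
  · simp [hfs]
  · intro y hy
    rw [sub_mul, mul_sub, hfc y hy, one_mul, mul_one]
  · change (1 - f) * r = 0
    rw [sub_mul, hfr, one_mul, sub_self]
  · change (1 - (1 - f)) * r' = 0
    rw [sub_sub_cancel, hfc r' hrM', hrf]

end VN
end UOC

set_option linter.unusedSimpArgs false
set_option linter.unusedVariables false
namespace UOC
section VN
variable {H : Type*} [NormedAddCommGroup H] [InnerProductSpace ℂ H] [CompleteSpace H]

lemma half_aux (M : VonNeumannAlgebra H) (a y w1 b z : H →L[ℂ] H) (haM : a ∈ M) (hyM : y ∈ M)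
    (hwM : w1 ∈ M)
    (haa : a * a = a) (has : star a = a) (hay : a * y = 0)
    (hw : b * w1 = w1) (hzz : z * z = z) (hzs : star z = z) (hzc : ∀ y ∈ M, z * y = y * z)
    (hzb : z * (b - star y * y) = 0) :
    star (z * (a + y * w1)) * (z * (a + y * w1)) = z * (a + star w1 * w1) := by
  have hya : star y * a = 0 := by simpa [has] using congrArg star hay
  have h1 : z * (star y * y) = z * b := by
    rw [mul_sub, sub_eq_zero] at hzb; exact hzb.symm
  have hT : a + y * w1 ∈ M := add_mem haM (mul_mem hyM hwM)
  rw [star_mul, hzs, mul_assoc, ← mul_assoc z z, hzz, ← mul_assoc, ← hzc _ (star_mem hT), mul_assoc]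
  have h2 : star (a + y * w1) * (a + y * w1) = a + star w1 * ((star y * y) * w1) := by
    simp only [star_add, star_mul, mul_add, add_mul, has, haa, mul_assoc, hya, mul_zero, add_zero]
    rw [← mul_assoc a y, hay]; simp
  rw [h2, mul_add, mul_add, ← mul_assoc z (star w1), hzc _ (star_mem hwM), mul_assoc _ z,
    ← mul_assoc z, h1, mul_assoc z, hw, ← mul_assoc, ← hzc _ (star_mem hwM), mul_assoc]

/-- half of the construction: for projections `e, g`. -/
lemma half_polar (M : VonNeumannAlgebra H) (e g : H →L[ℂ] H) (heM : e ∈ M) (hgM : g ∈ M)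
    (hee : e * e = e) (hes : star e = e) (hgg : g * g = g) (hgs : star g = g) :
    ∃ w ∈ M, ∃ a ∈ M, w * star w * w = w ∧ a * a = a ∧ star a = a ∧ a + star w * w = e ∧
      g * a = 0 ∧ g * w = w ∧ a * e = a ∧ (∀ y, y * (g * e) = 0 → y * w = 0) := by
  obtain ⟨w, hwM, h1, h2, h3, h4, h5⟩ := polar M (g * e) (mul_mem hgM heM)
  have hwe : w * e = w := by
    have := h4 (1 - e) (by rw [mul_sub, mul_one, mul_assoc, hee, sub_self])
    rw [mul_sub, mul_one, sub_eq_zero] at this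
    exact this.symm
  have hew : e * star w = star w := by simpa [hes] using congrArg star hwe
  have hgw : g * w = w := by
    have := h5 (1 - g) (by rw [sub_mul, one_mul, ← mul_assoc, hgg, sub_self])
    rw [sub_mul, one_mul, sub_eq_zero] at this
    exact this.symm
  have h6 : star w * w * (star w * w) = star w * w := by
    rw [mul_assoc, ← mul_assoc w, h1]
  refine ⟨w, hwM, e - star w * w, sub_mem heM (mul_mem (star_mem hwM) hwM), h1, ?_, ?_, ?_, ?_,
    hgw, ?_, h5⟩
  · rw [mul_sub, sub_mul, sub_mul, hee, ← mul_assoc e, hew, mul_assoc _ w e, hwe, h6]; abel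
  · simp [hes]
  · abel
  · have : g * (e - star w * w) = g * e - (g * e) * (star w * w) := by
      rw [mul_sub, mul_assoc g e, ← mul_assoc e, hew]
    rw [this, h2, sub_self]
  · rw [sub_mul, hee, mul_assoc, hwe]

lemma exists_iso_proj (M : VonNeumannAlgebra H) (v w g : H →L[ℂ] H) (hvM : v ∈ M) (hwM : w ∈ M)
    (hv : star v * v = 1) (hw : star w * w = 1) (hvw : star v * w = 0) (hgM : g ∈ M)
    (hgg : g * g = g) (hgs : star g = g) :
    ∃ f ∈ M, star f * f = 1 ∧ ∃ z ∈ M, z * z = z ∧ star z = z ∧ (∀ y ∈ M, z * y = y * z) ∧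
      g * f = f * z := by
  have h1M : (1 : H →L[ℂ] H) ∈ M := one_mem M
  set e := v * star v with he
  have heM : e ∈ M := mul_mem hvM (star_mem hvM)
  have hee : e * e = e := by rw [he, mul_assoc, ← mul_assoc (star v), hv, one_mul]
  have hes : star e = e := by simp [he]
  obtain ⟨w1, hw1M, a, haM, pw1, paa, pas, pae, pga, pgw, pa, p5⟩ :=
    half_polar M e g heM hgM hee hes hgg hgs
  obtain ⟨w2, hw2M, k, hkM, qw2, qkk, qks, qke, qgk, qgw, qk, q5⟩ :=
    half_polar M (1 - e) (1 - g) (sub_mem h1M heM) (sub_mem h1M hgM)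
    (by simp [mul_sub, sub_mul, hee]) (by simp [hes]) (by simp [mul_sub, sub_mul, hgg])
    (by simp [hgs])
  have hgk : g * k = k := by
    rw [sub_mul, one_mul, sub_eq_zero] at qgk; exact qgk.symm
  have hkg : k * g = k := by simpa [hgs, qks] using congrArg star hgk
  have hke : k * e = 0 := by
    rw [mul_sub, mul_one] at qk
    simpa using qk
  have hag : a * g = 0 := by simpa [hgs, pas] using congrArg star pga
  have hgw2 : g * w2 = 0 := by
    rw [sub_mul, one_mul] at qgw; simpa using qgw
  have hkw1 : k * w1 = 0 := p5 k (by rw [← mul_assoc, hkg, hke])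
  have haw2 : a * w2 = 0 := q5 a (by
    have h1 : a * (1 - g) = a := by rw [mul_sub, mul_one, hag, sub_zero]
    rw [← mul_assoc, h1, mul_sub, mul_one, pa, sub_self])
  obtain ⟨y, hyM, z, hzM, hzz, hzs, hzc, hyb, hdy, hyyy, hz1, hz2⟩ :=
    compare M (w1 * star w1) (w2 * star w2) (mul_mem hw1M (star_mem hw1M))
      (mul_mem hw2M (star_mem hw2M)) (by rw [← mul_assoc, pw1]) (by simp)
      (by rw [← mul_assoc, qw2]) (by simp)
  have hyb' : w1 * star w1 * star y = star y := by simpa [mul_assoc] using congrArg star hyb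
  have hay : a * y = 0 := by
    rw [← hdy, ← mul_assoc, ← mul_assoc, haw2]; simp
  have hky : k * star y = 0 := by
    rw [← hyb', ← mul_assoc, ← mul_assoc, hkw1]; simp
  have hgy : g * y = 0 := by
    rw [← hdy, ← mul_assoc, ← mul_assoc, hgw2]; simp
  have hgy' : g * star y = star y := by
    rw [← hyb', ← mul_assoc, ← mul_assoc, pgw]
  have hXX := half_aux M a y w1 (w1 * star w1) z haM hyM hw1M paa pas hay pw1 hzz hzs hzc hz1
  have hYY := half_aux M k (star y) w2 (w2 * star w2) (1 - z) hkM (star_mem hyM) hw2M qkk qks hky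
    qw2 (by simp [mul_sub, sub_mul, hzz]) (by simp [hzs])
    (fun y hy => by rw [sub_mul, mul_sub, hzc y hy, one_mul, mul_one]) (by rw [star_star]; exact hz2)
  rw [pae] at hXX
  rw [qke] at hYY
  have hzz0 : z * (1 - z) = 0 := by rw [mul_sub, mul_one, hzz, sub_self]
  have hzz1 : (1 - z) * z = 0 := by rw [sub_mul, one_mul, hzz, sub_self]
  set T := a + y * w1 with hT
  set S := k + star y * w2 with hS
  have hTM : T ∈ M := add_mem haM (mul_mem hyM hw1M)
  have hSM : S ∈ M := add_mem hkM (mul_mem (star_mem hyM) hw2M)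
  have hgX : g * (z * T) = 0 := by
    rw [← mul_assoc, ← hzc g hgM, mul_assoc, hT, mul_add, pga, ← mul_assoc, hgy]; simp
  have hgY : g * ((1 - z) * S) = (1 - z) * S := by
    have : g * S = S := by
      rw [hS, mul_add, hgk, ← mul_assoc, hgy']
    rw [← mul_assoc, mul_sub, mul_one, ← hzc g hgM, sub_mul, mul_assoc, this, sub_mul, one_mul]
  set X := z * T with hX
  set Y := (1 - z) * S with hY
  have hXM : X ∈ M := mul_mem hzM hTM
  have hYM : Y ∈ M := mul_mem (sub_mem h1M hzM) hSM
  have hXY : star X * Y = 0 := by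
    rw [hX, hY, star_mul, hzs, mul_assoc, ← mul_assoc z, hzz0]; simp
  have hYX : star Y * X = 0 := by simpa using congrArg star hXY
  have hev : star v * (z * e * v) = z := by
    rw [he, mul_assoc, mul_assoc, hv, mul_one, hzc v hvM, ← mul_assoc, hv, one_mul]
  have hew : star w * ((1 - z) * (1 - e) * w) = 1 - z := by
    have : (1 - e) * w = w := by rw [sub_mul, he, mul_assoc, hvw]; simp
    rw [mul_assoc, this, sub_mul, one_mul, mul_sub, hw, hzc w hwM, ← mul_assoc, hw, one_mul]
  refine ⟨X * v + Y * w, add_mem (mul_mem hXM hvM) (mul_mem hYM hwM), ?_, 1 - z,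
    sub_mem h1M hzM, by simp [mul_sub, sub_mul, hzz], by simp [hzs],
    fun y hy => by rw [sub_mul, mul_sub, hzc y hy, one_mul, mul_one], ?_⟩
  · have : star (X * v + Y * w) * (X * v + Y * w) = star v * ((star X * X) * v)
        + star v * ((star X * Y) * w) + star w * ((star Y * X) * v)
        + star w * ((star Y * Y) * w) := by
      simp only [star_add, star_mul, mul_add, add_mul, mul_assoc]; abel
    rw [this, hXX, hYY, hXY, hYX, hev, hew]; simp
  · have e1 : X * v * (1 - z) = 0 := by
      rw [mul_sub, mul_one, ← hzc _ (mul_mem hXM hvM), ← mul_assoc, hX, ← mul_assoc, hzz, sub_self]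
    have e2 : Y * w * (1 - z) = Y * w := by
      rw [mul_sub, mul_one, ← hzc _ (mul_mem hYM hwM), ← mul_assoc, hY, ← mul_assoc, hzz0]; simp
    rw [add_mul, e1, e2, mul_add, ← mul_assoc, hgX, ← mul_assoc, hgY]; simp

end VN
end UOC

set_option linter.unusedSimpArgs false
set_option linter.unusedVariables false
namespace UOC
section VN
variable {H : Type*} [NormedAddCommGroup H] [InnerProductSpace ℂ H] [CompleteSpace H]

lemma norm_le_of_sandwich {T : H →L[ℂ] H} (hT : IsSelfAdjoint T) {s : ℝ} (hs : 0 ≤ s)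
    (h1 : T ≤ algebraMap ℝ _ s) (h2 : -algebraMap ℝ _ s ≤ T) : ‖T‖ ≤ s := by
  rcases subsingleton_or_nontrivial (H →L[ℂ] H) with h | h
  · rw [Subsingleton.elim T 0]; simpa using hs
  · rw [le_algebraMap_iff_spectrum_le] at h1
    rw [← map_neg, algebraMap_le_iff_le_spectrum] at h2
    rcases CStarAlgebra.norm_or_neg_norm_mem_spectrum hT with h | h
    · exact h1 _ h
    · have := h2 _ h
      linarith

lemma iso_norm {z : H →L[ℂ] H} (hz : star z * z = 1) : ‖z‖ ≤ 1 :=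
  piso_norm (by rw [mul_assoc, hz, mul_one])

lemma bisect_norm {P N z : H →L[ℂ] H} {r : ℝ} (hr0 : 0 ≤ r) (hPs : IsSelfAdjoint P)
    (hNs : IsSelfAdjoint N) (hz : IsSelfAdjoint z) (hP0 : 0 ≤ P) (hP : P ≤ r • z)
    (hN0 : 0 ≤ N) (hN : N ≤ r • (1 - z)) :
    ‖P - N - (r • z - (r / 2) • (1 : H →L[ℂ] H))‖ ≤ r / 2 := by
  have hr1 : r • (1 : H →L[ℂ] H) = (r / 2) • 1 + (r / 2) • 1 := by rw [← add_smul]; norm_num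
  refine norm_le_of_sandwich ?_ (by positivity) ?_ ?_
  · exact (hPs.sub hNs).sub ((IsSelfAdjoint.smul (star_trivial _) hz).sub
      (IsSelfAdjoint.smul (star_trivial _) (IsSelfAdjoint.one _)))
  · rw [Algebra.algebraMap_eq_smul_one]
    have h1 := sub_le_sub_right (sub_le_sub hP hN0) (r • z - (r / 2) • (1 : H →L[ℂ] H))
    refine h1.trans_eq ?_
    abel
  · rw [Algebra.algebraMap_eq_smul_one]
    have h1 := sub_le_sub_right (sub_le_sub hP0 hN) (r • z - (r / 2) • (1 : H →L[ℂ] H))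
    refine le_trans (le_of_eq ?_) h1
    rw [smul_sub, hr1]; abel

set_option maxHeartbeats 800000 in
lemma bisect (M : VonNeumannAlgebra H) (v w : H →L[ℂ] H) (hvM : v ∈ M) (hwM : w ∈ M)
    (hv : star v * v = 1) (hw : star w * w = 1) (hvw : star v * w = 0)
    (h ζ : H →L[ℂ] H) (hM : h ∈ M) (hs : star h = h) (hζM : ζ ∈ M) (hζs : star ζ = ζ)
    (hζc : ∀ y ∈ M, ζ * y = y * ζ) (r : ℝ) (hr : ‖h - ζ‖ ≤ r) :
    ∃ f ∈ M, star f * f = 1 ∧ ∃ ζ' ∈ M, star ζ' = ζ' ∧ (∀ y ∈ M, ζ' * y = y * ζ') ∧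
      ‖star f * h * f - ζ'‖ ≤ r / 2 := by
  have hr0 : 0 ≤ r := (norm_nonneg _).trans hr
  set c := h - ζ with hc
  have hcM : c ∈ M := sub_mem hM hζM
  have hcs : IsSelfAdjoint c := by
    rw [IsSelfAdjoint, hc, star_sub, hs, hζs]
  have hpM : c⁺ ∈ M := by
    refine mem_of_comm M _ fun y hy => ?_
    have h1 : Commute c y := comm_of_mem hcM hy
    exact (h1.cfcₙ_real (·⁺ : ℝ → ℝ)).eq.symm
  have hp0 : (0 : H →L[ℂ] H) ≤ c⁺ := CFC.posPart_nonneg c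
  have hn0 : (0 : H →L[ℂ] H) ≤ c⁻ := CFC.negPart_nonneg c
  have hps : star (c⁺) = c⁺ := (IsSelfAdjoint.of_nonneg hp0)
  have hns : star (c⁻) = c⁻ := (IsSelfAdjoint.of_nonneg hn0)
  have hpr : c⁺ ≤ algebraMap ℝ (H →L[ℂ] H) r :=
    (CStarAlgebra.norm_le_iff_le_algebraMap _ hr0 hp0).1 ((CStarAlgebra.norm_posPart_le c).trans hr)
  have hnr : c⁻ ≤ algebraMap ℝ (H →L[ℂ] H) r :=
    (CStarAlgebra.norm_le_iff_le_algebraMap _ hr0 hn0).1 ((CStarAlgebra.norm_negPart_le c).trans hr)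
  obtain ⟨g, hgM, hgg, hgs, -, hgU, hg0⟩ := exists_range_proj M (c⁺).range (by
    rintro y hy _ ⟨k, rfl⟩
    exact ⟨y k, (congrArg (fun z : H →L[ℂ] H => z k) (comm_of_mem hpM hy))⟩)
  have hgp : g * c⁺ = c⁺ := by
    ext k; exact hgU _ ⟨k, rfl⟩
  have hpg : c⁺ * g = c⁺ := by simpa [hgs, hps] using congrArg star hgp
  have hng : c⁻ * g = 0 := by
    refine hg0 _ ?_
    rintro _ ⟨k, rfl⟩
    exact congrArg (fun z : H →L[ℂ] H => z k) (CFC.negPart_mul_posPart c)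
  have hgn : g * c⁻ = 0 := by simpa [hgs, hns] using congrArg star hng
  obtain ⟨f, hfM, hf, z, hzM, hzz, hzs, hzc, hgf⟩ :=
    exists_iso_proj M v w g hvM hwM hv hw hvw hgM hgg hgs
  have hfg : star f * g = z * star f := by simpa [hgs, hzs] using congrArg star hgf
  have hP : star f * c⁺ * f ≤ r • z := by
    have e1 : star f * c⁺ * f = z * (star f * c⁺ * f) * z := by
      conv_lhs => rw [← hgp, ← hpg]
      simp only [← mul_assoc, hfg]
      simp only [mul_assoc, hgf]
    have e2 : star f * c⁺ * f ≤ star f * (algebraMap ℝ (H →L[ℂ] H) r) * f :=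
      star_left_conjugate_le_conjugate hpr f
    have e3 := star_left_conjugate_le_conjugate e2 z
    rw [hzs, ← e1] at e3
    refine e3.trans_eq ?_
    simp [Algebra.algebraMap_eq_smul_one, hf, hzz]
  have hN : star f * c⁻ * f ≤ r • (1 - z) := by
    have g1 : (1 - g) * c⁻ = c⁻ := by rw [sub_mul, hgn]; simp
    have g2 : c⁻ * (1 - g) = c⁻ := by rw [mul_sub, hng]; simp
    have g3 : (1 - g) * f = f * (1 - z) := by rw [sub_mul, mul_sub, hgf]; simp
    have g4 : star f * (1 - g) = (1 - z) * star f := by rw [sub_mul, mul_sub, hfg]; simp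
    have e1 : star f * c⁻ * f = (1 - z) * (star f * c⁻ * f) * (1 - z) := by
      conv_lhs => rw [← g1, ← g2]
      simp only [← mul_assoc, g4]
      simp only [mul_assoc, g3]
    have e2 : star f * c⁻ * f ≤ star f * (algebraMap ℝ (H →L[ℂ] H) r) * f :=
      star_left_conjugate_le_conjugate hnr f
    have e3 := star_left_conjugate_le_conjugate e2 (1 - z)
    have hz' : star (1 - z) = 1 - z := by simp [hzs]
    have hz'' : (1 - z) * (1 - z) = 1 - z := by simp [mul_sub, sub_mul, hzz]
    rw [hz', ← e1] at e3
    refine e3.trans_eq ?_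
    simp [Algebra.algebraMap_eq_smul_one, hf, hz'']
  have hP0 : 0 ≤ star f * c⁺ * f := star_left_conjugate_nonneg hp0 f
  have hN0 : 0 ≤ star f * c⁻ * f := star_left_conjugate_nonneg hn0 f
  have hζ'M : ζ + (r • z - (r / 2) • (1 : H →L[ℂ] H)) ∈ M :=
    add_mem hζM (sub_mem (rsmul_mem' hzM r) (rsmul_mem' (one_mem M) _))
  refine ⟨f, hfM, hf, ζ + (r • z - (r / 2) • (1 : H →L[ℂ] H)), hζ'M, ?_, ?_, ?_⟩
  · simp [hζs, hzs]
  · intro y hy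
    simp only [add_mul, sub_mul, mul_add, mul_sub, smul_mul_assoc, mul_smul_comm, one_mul, mul_one,
      hζc y hy, hzc y hy]
  · have e : star f * h * f - (ζ + (r • z - (r / 2) • (1 : H →L[ℂ] H))) =
        star f * c⁺ * f - star f * c⁻ * f - (r • z - (r / 2) • (1 : H →L[ℂ] H)) := by
      have e1 : star f * c⁺ * f - star f * c⁻ * f = star f * c * f := by
        rw [← sub_mul, ← mul_sub, CFC.posPart_sub_negPart c hcs]
      have e2 : star f * ζ * f = ζ := by
        rw [mul_assoc, hζc f hfM, ← mul_assoc, hf, one_mul]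
      rw [e1, hc, mul_sub, sub_mul, e2]; abel
    rw [e]
    exact bisect_norm hr0 (IsSelfAdjoint.of_nonneg hP0) (IsSelfAdjoint.of_nonneg hN0) hzs hP0 hP hN0 hN

lemma conj_mul_aux (f g h : H →L[ℂ] H) : star (f * g) * h * (f * g) = star g * (star f * h * f) * g := by
  simp only [star_mul, mul_assoc]

lemma iso_mul {f g : H →L[ℂ] H} (hf : star f * f = 1) (hg : star g * g = 1) :
    star (f * g) * (f * g) = 1 := by
  rw [star_mul, mul_assoc, ← mul_assoc (star f), hf, one_mul, hg]

lemma conj_close {M : VonNeumannAlgebra H} {f ζ h : H →L[ℂ] H} (hfM : f ∈ M)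
    (hf : star f * f = 1) (hζc : ∀ y ∈ M, ζ * y = y * ζ) :
    ‖star f * h * f - ζ‖ ≤ ‖h - ζ‖ := by
  have e2 : star f * ζ * f = ζ := by
    rw [mul_assoc, hζc f hfM, ← mul_assoc, hf, one_mul]
  have e : star f * h * f - ζ = star f * (h - ζ) * f := by
    rw [mul_sub, sub_mul, e2]
  rw [e]
  have := iso_norm hf
  calc _ ≤ ‖star f‖ * ‖h - ζ‖ * ‖f‖ := norm_mul₃_le
    _ ≤ 1 * ‖h - ζ‖ * 1 := by rw [norm_star]; gcongr
    _ = _ := by ring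

lemma dixmier_sa (M : VonNeumannAlgebra H) (v w : H →L[ℂ] H) (hvM : v ∈ M) (hwM : w ∈ M)
    (hv : star v * v = 1) (hw : star w * w = 1) (hvw : star v * w = 0)
    (h : H →L[ℂ] H) (hM : h ∈ M) (hs : star h = h) (δ : ℝ) (hδ : 0 < δ) :
    ∃ f ∈ M, star f * f = 1 ∧ ∃ ζ ∈ M, star ζ = ζ ∧ (∀ y ∈ M, ζ * y = y * ζ) ∧
      ‖star f * h * f - ζ‖ < δ := by
  have key : ∀ n : ℕ, ∃ f ∈ M, star f * f = 1 ∧ ∃ ζ ∈ M, star ζ = ζ ∧ (∀ y ∈ M, ζ * y = y * ζ) ∧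
      ‖star f * h * f - ζ‖ ≤ ‖h‖ / 2 ^ n := by
    intro n
    induction n with
    | zero =>
      exact ⟨1, one_mem M, by simp, 0, zero_mem M, by simp, by simp, by simp⟩
    | succ n ih =>
      obtain ⟨f, hfM, hf, ζ, hζM, hζs, hζc, hn⟩ := ih
      obtain ⟨g, hgM, hg, ζ', hζ'M, hζ's, hζ'c, hn'⟩ := bisect M v w hvM hwM hv hw hvw
        (star f * h * f) ζ (mul_mem (mul_mem (star_mem hfM) hM) hfM)
        (by simp [hs, mul_assoc]) hζM hζs hζc _ hn
      refine ⟨f * g, mul_mem hfM hgM, iso_mul hf hg, ζ', hζ'M, hζ's, hζ'c, ?_⟩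
      rw [conj_mul_aux, pow_succ, ← div_div]
      exact hn'
  obtain ⟨n, hn⟩ : ∃ n : ℕ, ‖h‖ / 2 ^ n < δ := by
    have h1 : Filter.Tendsto (fun n : ℕ => ‖h‖ * (1 / 2 : ℝ) ^ n) Filter.atTop (nhds (‖h‖ * 0)) :=
      (tendsto_pow_atTop_nhds_zero_of_lt_one (by norm_num) (by norm_num)).const_mul _
    rw [mul_zero] at h1
    obtain ⟨n, hn⟩ := (h1.eventually (gt_mem_nhds hδ)).exists
    refine ⟨n, ?_⟩
    simpa [div_eq_mul_inv] using hn
  obtain ⟨f, hfM, hf, ζ, hζM, hζs, hζc, h1⟩ := key n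
  exact ⟨f, hfM, hf, ζ, hζM, hζs, hζc, h1.trans_lt hn⟩

lemma dixmier_one (M : VonNeumannAlgebra H) (v w : H →L[ℂ] H) (hvM : v ∈ M) (hwM : w ∈ M)
    (hv : star v * v = 1) (hw : star w * w = 1) (hvw : star v * w = 0)
    (h : H →L[ℂ] H) (hM : h ∈ M) (δ : ℝ) (hδ : 0 < δ) :
    ∃ f ∈ M, star f * f = 1 ∧ ∃ ζ ∈ M, (∀ y ∈ M, ζ * y = y * ζ) ∧
      ‖star f * h * f - ζ‖ < δ := by
  have h2M : ∀ x ∈ M, (2⁻¹ : ℂ) • x ∈ M := fun x hx => smul_mem' hx _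
  set a := (2⁻¹ : ℂ) • (h + star h) with ha
  set b := (2⁻¹ : ℂ) • (Complex.I • (star h - h)) with hb
  have haM : a ∈ M := smul_mem' (add_mem hM (star_mem hM)) _
  have hbM : b ∈ M := smul_mem' (smul_mem' (sub_mem (star_mem hM) hM) _) _
  have has : star a = a := by simp [ha, add_comm]
  have hbs : star b = b := by
    simp only [hb, star_smul, star_sub, star_star, Complex.star_def, map_inv₀, map_ofNat,
      Complex.conj_I]
    rw [neg_smul, ← smul_neg, neg_sub]
  have hab : h = a + Complex.I • b := by
    have e1 : Complex.I • b = (2⁻¹ : ℂ) • (h - star h) := by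
      rw [hb, smul_comm, smul_smul Complex.I Complex.I, Complex.I_mul_I, neg_one_smul, neg_sub]
    rw [e1, ha, ← smul_add]
    have : h + star h + (h - star h) = (2 : ℂ) • h := by rw [two_smul]; abel
    rw [this, smul_smul]; norm_num
  obtain ⟨f, hfM, hf, ζ, hζM, hζs, hζc, h1⟩ := dixmier_sa M v w hvM hwM hv hw hvw a haM has (δ / 2)
    (by positivity)
  obtain ⟨g, hgM, hg, ξ, hξM, hξs, hξc, h2⟩ := dixmier_sa M v w hvM hwM hv hw hvw (star f * b * f)
    (mul_mem (mul_mem (star_mem hfM) hbM) hfM) (by simp [hbs, mul_assoc]) (δ / 2) (by positivity)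
  refine ⟨f * g, mul_mem hfM hgM, iso_mul hf hg, ζ + Complex.I • ξ,
    add_mem hζM (smul_mem' hξM _), ?_, ?_⟩
  · intro y hy
    rw [add_mul, mul_add, hζc y hy, smul_mul_assoc, hξc y hy, mul_smul_comm]
  · have h3 := conj_close (h := star f * a * f) hgM hg hζc
    have e : star (f * g) * h * (f * g) - (ζ + Complex.I • ξ) =
        (star g * (star f * a * f) * g - ζ) + Complex.I • (star g * (star f * b * f) * g - ξ) := by
      rw [conj_mul_aux, hab]
      simp only [mul_add, add_mul, mul_smul_comm, smul_mul_assoc, smul_sub]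
      abel
    rw [e]
    refine (norm_add_le _ _).trans_lt ?_
    rw [norm_smul, Complex.norm_I, one_mul]
    linarith

lemma dixmier (M : VonNeumannAlgebra H) (v w : H →L[ℂ] H) (hvM : v ∈ M) (hwM : w ∈ M)
    (hv : star v * v = 1) (hw : star w * w = 1) (hvw : star v * w = 0)
    (B : Set (H →L[ℂ] H)) (hB : B.Finite) (hBM : ∀ b ∈ B, b ∈ M) (δ : ℝ) (hδ : 0 < δ) :
    ∃ f ∈ M, star f * f = 1 ∧ ∀ b ∈ B, ∃ ζ ∈ M, (∀ y ∈ M, ζ * y = y * ζ) ∧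
      ‖star f * b * f - ζ‖ < δ := by
  induction B, hB using Set.Finite.induction_on with
  | empty => exact ⟨1, one_mem M, by simp, by simp⟩
  | @insert b B _ _ ih =>
    obtain ⟨f, hfM, hf, h1⟩ := ih (fun b hb => hBM b (Set.mem_insert_of_mem _ hb))
    have hbM := hBM b (Set.mem_insert _ _)
    obtain ⟨g, hgM, hg, ζ, hζM, hζc, h2⟩ := dixmier_one M v w hvM hwM hv hw hvw (star f * b * f)
      (mul_mem (mul_mem (star_mem hfM) hbM) hfM) δ hδ
    refine ⟨f * g, mul_mem hfM hgM, iso_mul hf hg, ?_⟩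
    rintro x (rfl | hx)
    · exact ⟨ζ, hζM, hζc, by rw [conj_mul_aux]; exact h2⟩
    · obtain ⟨ξ, hξM, hξc, h3⟩ := h1 x hx
      exact ⟨ξ, hξM, hξc, by rw [conj_mul_aux]; exact (conj_close hgM hg hξc).trans_lt h3⟩

end VN
end UOC

set_option linter.unusedSimpArgs false
set_option linter.unusedVariables false
namespace UOC
section VN
variable {H : Type*} [NormedAddCommGroup H] [InnerProductSpace ℂ H] [CompleteSpace H]

lemma isClosed_vn (M : VonNeumannAlgebra H) :
    IsClosed ((M.toStarSubalgebra : StarSubalgebra ℂ (H →L[ℂ] H)) : Set (H →L[ℂ] H)) := by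
  have h : ((M.toStarSubalgebra : StarSubalgebra ℂ (H →L[ℂ] H)) : Set (H →L[ℂ] H)) =
      Set.centralizer (M.commutant : Set (H →L[ℂ] H)) := by
    rw [← VonNeumannAlgebra.coe_commutant, VonNeumannAlgebra.commutant_commutant]; rfl
  rw [h]
  exact Set.isClosed_centralizer _

lemma kuiper_vn (M : VonNeumannAlgebra H) (v w : H →L[ℂ] H) (hvM : v ∈ M) (hwM : w ∈ M)
    (hv : star v * v = 1) (hw : star w * w = 1) (hvw : star v * w = 0)
    {K : Type*} [TopologicalSpace K] [CompactSpace K] (f g : K → H →L[ℂ] H)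
    (hf : Continuous f) (hg : Continuous g) (hfM : ∀ x, f x ∈ M) (hgM : ∀ x, g x ∈ M)
    (hfg : ∀ x, f x * g x = 1) (hgf : ∀ x, g x * f x = 1) :
    ∃ F : unitInterval × K → H →L[ℂ] H, Continuous F ∧ (∀ z, F z ∈ M) ∧ (∀ z, IsUnit (F z)) ∧
      (∀ x, F (0, x) = f x) ∧ ∀ x, F (1, x) = 1 := by
  have : IsClosed ((M.toStarSubalgebra : StarSubalgebra ℂ (H →L[ℂ] H)) : Set (H →L[ℂ] H)) :=
    isClosed_vn M
  let A := M.toStarSubalgebra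
  let _ : CStarAlgebra A := StarSubalgebra.cstarAlgebra A
  obtain ⟨Ψ, hΨM, hΨn, hΨa, hΨm, hΨs⟩ := exists_psi M v w hvM hwM hv hw hvw
  have hΨ0 : Ψ 0 = 0 := by
    have := hΨa 0 (zero_mem M) 0 (zero_mem M)
    simpa using this
  let Φ : A →ₙ+* A :=
    { toFun := fun x => ⟨Ψ x, hΨM _ x.2⟩
      map_mul' := fun x y => Subtype.ext (hΨm _ x.2 _ y.2)
      map_zero' := Subtype.ext hΨ0
      map_add' := fun x y => Subtype.ext (hΨa _ x.2 _ y.2) }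
  have hΦ : Continuous Φ :=
    AddMonoidHomClass.continuous_of_bound Φ 1 fun x => by
      rw [one_mul]; exact hΨn _ x.2
  let v' : A := ⟨v, hvM⟩
  let w' : A := ⟨w, hwM⟩
  have hwv : star w * v = 0 := by simpa using congrArg star hvw
  let u : C(K, Aˣ) := mkU ⟨fun x => ⟨f x, hfM x⟩, hf.subtype_mk _⟩
    ⟨fun x => ⟨g x, hgM x⟩, hg.subtype_mk _⟩ (fun x => Subtype.ext (hfg x))
    (fun x => Subtype.ext (hgf x))
  have hu : u ∈ Nul A K := by
    refine kuiper Φ hΦ v' w' (Subtype.ext hv) (Subtype.ext hw) (Subtype.ext hvw)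
      (fun x => Subtype.ext (hΨs _ x.2)) ?_ u
    intro B hB δ hδ
    obtain ⟨q, hqM, hq, hq'⟩ := dixmier M v w hvM hwM hv hw hvw (Subtype.val '' B)
      (hB.image _) (by rintro _ ⟨b, _, rfl⟩; exact b.2) δ hδ
    refine ⟨⟨q * v, mul_mem hqM hvM⟩, ⟨q * w, mul_mem hqM hwM⟩, Subtype.ext (iso_mul hq hv),
      Subtype.ext (iso_mul hq hw), Subtype.ext ?_, ?_⟩
    · change star (q * w) * (q * v) = 0
      rw [star_mul, mul_assoc, ← mul_assoc (star q), hq, one_mul, hwv]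
    · intro b hb
      obtain ⟨ζ, hζM, hζc, hζ⟩ := hq' b ⟨b, hb, rfl⟩
      change ‖star (q * w) * (b : H →L[ℂ] H) * (q * v)‖ < δ
      have e : star (q * w) * (b : H →L[ℂ] H) * (q * v) =
          star w * (star q * (b : H →L[ℂ] H) * q - ζ) * v := by
        have : star w * ζ * v = 0 := by
          rw [mul_assoc, hζc v hvM, ← mul_assoc, hwv, zero_mul]
        rw [mul_sub, sub_mul, this, sub_zero, star_mul]; simp only [mul_assoc]
      rw [e]
      refine lt_of_le_of_lt ?_ hζ
      have h1 : ‖star w‖ ≤ 1 := by rw [norm_star]; exact iso_norm hw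
      have h2 : ‖v‖ ≤ 1 := iso_norm hv
      calc _ ≤ ‖star w‖ * ‖star q * (b : H →L[ℂ] H) * q - ζ‖ * ‖v‖ :=
            (norm_mul_le _ _).trans (mul_le_mul_of_nonneg_right (norm_mul_le _ _) (norm_nonneg _))
        _ ≤ 1 * ‖star q * (b : H →L[ℂ] H) * q - ζ‖ * 1 := by gcongr
        _ = _ := by ring
  obtain ⟨F, hF0, hF1⟩ := hu
  refine ⟨fun z => ((F z : Aˣ) : A), ?_, fun z => ((F z : Aˣ) : A).2, fun z => ?_, fun x => ?_,
    fun x => ?_⟩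
  · exact continuous_subtype_val.comp (continuous_val F)
  · exact (F z).isUnit.map A.subtype
  · beta_reduce; rw [hF0]; rfl
  · beta_reduce; rw [hF1]; rfl

end VN
end UOC

set_option linter.unusedSimpArgs false
set_option linter.unusedVariables false
namespace UOC
section VN
variable {H : Type*} [NormedAddCommGroup H] [InnerProductSpace ℂ H] [CompleteSpace H]

/-- inverse square root -/
noncomputable def isq (a : H →L[ℂ] H) : H →L[ℂ] H := cfc (fun t : ℝ => (Real.sqrt t)⁻¹) a

/-- unitary part of the polar decomposition of an invertible element -/
noncomputable def pol (x : H →L[ℂ] H) : H →L[ℂ] H := x * isq (star x * x)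

lemma isUnit_star_mul {x : H →L[ℂ] H} (hx : IsUnit x) : IsUnit (star x * x) := hx.star.mul hx

lemma spec_pos {x : H →L[ℂ] H} (hx : IsUnit x) : spectrum ℝ (star x * x) ⊆ Set.Ioi 0 := by
  intro t ht
  have h0 : 0 ≤ t := spectrum_nonneg_of_nonneg (star_mul_self_nonneg x) ht
  refine lt_of_le_of_ne h0 ?_
  rintro rfl
  exact spectrum.zero_notMem ℝ (isUnit_star_mul hx) ht

lemma isq_contOn : ContinuousOn (fun t : ℝ => (Real.sqrt t)⁻¹) (Set.Ioi 0) := by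
  refine ContinuousOn.inv₀ Real.continuous_sqrt.continuousOn fun t ht => ?_
  exact (Real.sqrt_pos.2 ht).ne'

lemma isq_sa (a : H →L[ℂ] H) : star (isq a) = isq a :=
  show IsSelfAdjoint (isq a) from cfc_predicate (R := ℝ) _ a

lemma isq_comm {a b : H →L[ℂ] H} (h : a * b = b * a) : isq a * b = b * isq a :=
  (Commute.cfc_real (show Commute a b from h) _).eq

lemma isq_mul {x : H →L[ℂ] H} (hx : IsUnit x) :
    isq (star x * x) * (star x * x) * isq (star x * x) = 1 := by
  have hc := isq_contOn.mono (spec_pos hx)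
  have hsa : IsSelfAdjoint (star x * x) := IsSelfAdjoint.star_mul_self x
  have e : isq (star x * x) * (star x * x) * isq (star x * x) =
      cfc (fun t : ℝ => (Real.sqrt t)⁻¹ * t * (Real.sqrt t)⁻¹) (star x * x) := by
    rw [cfc_mul (fun t : ℝ => (Real.sqrt t)⁻¹ * t) _ _ (hc.mul continuousOn_id) hc,
      cfc_mul (fun t : ℝ => (Real.sqrt t)⁻¹) (fun t => t) _ hc continuousOn_id, cfc_id' ℝ (star x * x)]
    rfl
  rw [e, ← cfc_one ℝ (star x * x)]
  refine cfc_congr fun t ht => ?_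
  have h0 : 0 < t := spec_pos hx ht
  have h1 : 0 < Real.sqrt t := Real.sqrt_pos.2 h0
  change (Real.sqrt t)⁻¹ * t * (Real.sqrt t)⁻¹ = 1
  field_simp
  exact (Real.sq_sqrt h0.le).symm

lemma isq_cont : ContinuousOn (fun x : H →L[ℂ] H => isq (star x * x)) {x | IsUnit x} := by
  refine ContinuousOn.cfc_of_mem_nhdsSet (s := Set.Ioi 0) _ ?_ (by fun_prop)
    (fun x _ => IsSelfAdjoint.star_mul_self x) isq_contOn
  exact isOpen_Ioi.mem_nhdsSet.2 (Set.iUnion₂_subset fun x hx => spec_pos hx)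

lemma pol_cont : ContinuousOn (pol (H := H)) {x | IsUnit x} := continuousOn_id.mul isq_cont

lemma pol_mul {u : H →L[ℂ] H} (hu : star u * u = 1) (x : H →L[ℂ] H) : pol (u * x) = u * pol x := by
  have : star (u * x) * (u * x) = star x * x := by
    rw [star_mul, mul_assoc, ← mul_assoc (star u), hu, one_mul]
  rw [pol, this, pol, mul_assoc]

lemma isq_one : isq (1 : H →L[ℂ] H) = 1 := by
  rw [isq, cfc_apply_one]; simp

lemma pol_one : pol (1 : H →L[ℂ] H) = 1 := by simp [pol, isq_one]

lemma pol_unitary {u : H →L[ℂ] H} (hu : star u * u = 1) : pol u = u := by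
  have := pol_mul hu 1
  simpa [pol_one] using this

lemma pol_left {x : H →L[ℂ] H} (hx : IsUnit x) : star (pol x) * pol x = 1 := by
  rw [← isq_mul hx, pol, star_mul, isq_sa]; simp only [mul_assoc]

lemma isUnit_isq {x : H →L[ℂ] H} (hx : IsUnit x) : IsUnit (isq (star x * x)) := by
  have h1 := isq_mul hx
  refine isUnit_iff_exists.2 ⟨(star x * x) * isq (star x * x), by rw [← mul_assoc]; exact h1, ?_⟩
  rw [isq_comm rfl] at h1
  rw [mul_assoc] at h1
  rw [mul_assoc]; exact h1

lemma pol_right {x : H →L[ℂ] H} (hx : IsUnit x) : pol x * star (pol x) = 1 := by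
  have h : IsUnit (pol x) := hx.mul (isUnit_isq hx)
  obtain ⟨y, hy⟩ := h.exists_right_inv
  have : star (pol x) = y := left_inv_eq_right_inv (pol_left hx) hy
  rw [this, hy]

lemma pol_mem {M : VonNeumannAlgebra H} {x : H →L[ℂ] H} (hx : x ∈ M) : pol x ∈ M := by
  refine mul_mem hx (mem_of_comm M _ fun y hy => ?_)
  exact (isq_comm (comm_of_mem (mul_mem (star_mem hx) hx) hy)).symm

lemma pol_sa {x : H →L[ℂ] H} (hx : star x = x) : star (pol x) = pol x := by
  rw [pol, star_mul, isq_sa, hx]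
  exact isq_comm (by rw [mul_assoc])

lemma pol_intertwine {x q q' : H →L[ℂ] H} (hq : star q = q) (hq' : star q' = q')
    (h : x * q' = q * x) : pol x * q' = q * pol x := by
  have h' : q' * star x = star x * q := by simpa [hq, hq'] using congrArg star h
  rw [pol, mul_assoc, isq_comm (b := q') (by
    rw [mul_assoc, h, ← mul_assoc, ← h', mul_assoc]), ← mul_assoc, h, mul_assoc]

end VN
end UOC

set_option linter.unusedSimpArgs false
set_option linter.unusedVariables false
namespace UOC
section VN
variable {H : Type*} [NormedAddCommGroup H] [InnerProductSpace ℂ H] [CompleteSpace H]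

/-- unitaries of `M` -/
def IsU (M : VonNeumannAlgebra H) (x : H →L[ℂ] H) : Prop :=
  x ∈ M ∧ star x * x = 1 ∧ x * star x = 1

lemma IsU.one (M : VonNeumannAlgebra H) : IsU M 1 := ⟨one_mem M, by simp, by simp⟩

lemma IsU.mul {M : VonNeumannAlgebra H} {x y : H →L[ℂ] H} (hx : IsU M x) (hy : IsU M y) :
    IsU M (x * y) := by
  refine ⟨mul_mem hx.1 hy.1, iso_mul hx.2.1 hy.2.1, ?_⟩
  have := iso_mul (f := star y) (g := star x) (by simpa using hy.2.2) (by simpa using hx.2.2)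
  simpa using this

lemma IsU.star {M : VonNeumannAlgebra H} {x : H →L[ℂ] H} (hx : IsU M x) : IsU M (star x) :=
  ⟨star_mem hx.1, by simpa using hx.2.2, by simpa using hx.2.1⟩

lemma IsU.isUnit {M : VonNeumannAlgebra H} {x : H →L[ℂ] H} (hx : IsU M x) : IsUnit x :=
  isUnit_iff_exists.2 ⟨_, hx.2.2, hx.2.1⟩

lemma isU_pol {M : VonNeumannAlgebra H} {x : H →L[ℂ] H} (hx : x ∈ M) (hu : IsUnit x) :
    IsU M (pol x) := ⟨pol_mem hx, pol_left hu, pol_right hu⟩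

/-- `M` contains two isometries with orthogonal ranges -/
def PInf (M : VonNeumannAlgebra H) : Prop :=
  ∃ v ∈ M, ∃ w ∈ M, star v * v = 1 ∧ star w * w = 1 ∧ star v * w = 0

lemma kuiper_on {M : VonNeumannAlgebra H} (hM : PInf M) {X : Type*} [TopologicalSpace X]
    {S : Set X} (hS : IsCompact S) (f : X → H →L[ℂ] H) (hf : ContinuousOn f S)
    (hfU : ∀ x ∈ S, IsU M (f x)) :
    ∃ F : ℝ × X → H →L[ℂ] H, ContinuousOn F (Set.Icc 0 1 ×ˢ S) ∧
      (∀ z ∈ Set.Icc (0 : ℝ) 1 ×ˢ S, IsU M (F z)) ∧ (∀ x ∈ S, F (0, x) = f x) ∧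
      ∀ x ∈ S, F (1, x) = 1 := by
  classical
  obtain ⟨v, hvM, w, hwM, hv, hw, hvw⟩ := hM
  have : CompactSpace S := isCompact_iff_compactSpace.1 hS
  have hfc : Continuous fun x : S => f x := continuousOn_iff_continuous_domRestrict.1 hf
  obtain ⟨F, hFc, hFM, hFu, hF0, hF1⟩ := kuiper_vn M v w hvM hwM hv hw hvw (K := S)
    (fun x => f x) (fun x => star (f x)) hfc hfc.star
    (fun x => (hfU x x.2).1) (fun x => star_mem (hfU x x.2).1)
    (fun x => (hfU x x.2).2.2) (fun x => (hfU x x.2).2.1)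
  refine ⟨fun z => if h : z.1 ∈ Set.Icc (0 : ℝ) 1 ∧ z.2 ∈ S then
    pol (F (⟨z.1, h.1⟩, ⟨z.2, h.2⟩)) else 1, ?_, ?_, ?_, ?_⟩
  · rw [continuousOn_iff_continuous_domRestrict]
    have h1 : Continuous fun z : unitInterval × S => pol (F z) :=
      pol_cont.comp_continuous hFc hFu
    have h2 : Continuous fun z : (Set.Icc (0 : ℝ) 1 ×ˢ S : Set (ℝ × X)) =>
        pol (F (⟨z.1.1, (Set.mem_prod.1 z.2).1⟩, ⟨z.1.2, (Set.mem_prod.1 z.2).2⟩)) :=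
      h1.comp (by fun_prop)
    refine h2.congr fun z => ?_
    rw [Set.domRestrict_apply, dif_pos (Set.mem_prod.1 z.2)]
  · intro z hz
    have hz' : z.1 ∈ Set.Icc (0 : ℝ) 1 ∧ z.2 ∈ S := hz
    beta_reduce
    rw [dif_pos hz']
    exact isU_pol (hFM _) (hFu _)
  · intro x hx
    beta_reduce
    rw [dif_pos ⟨by simp, hx⟩]
    have : F (⟨(0, x).1, by simp⟩, ⟨(0, x).2, hx⟩) = f x := hF0 ⟨x, hx⟩
    rw [this, pol_unitary (hfU x hx).2.1]
  · intro x hx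
    beta_reduce
    rw [dif_pos ⟨by simp, hx⟩]
    have : F (⟨(1, x).1, by simp⟩, ⟨(1, x).2, hx⟩) = 1 := hF1 ⟨x, hx⟩
    rw [this, pol_one]

end VN

section Simp
variable {I : Type*}

/-- simplex spanned by a finite set -/
def Dl (τ : Finset I) : Set (I → ℝ) :=
  {μ | (∀ i, 0 ≤ μ i) ∧ (∀ i, i ∉ τ → μ i = 0) ∧ ∑ i ∈ τ, μ i = 1}

/-- its boundary -/
def Bd (τ : Finset I) : Set (I → ℝ) := {μ | μ ∈ Dl τ ∧ ∃ i ∈ τ, μ i = 0}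

lemma isClosed_Dl (τ : Finset I) : IsClosed (Dl τ) := by
  have : Dl τ = (⋂ i, {μ : I → ℝ | 0 ≤ μ i}) ∩ (⋂ i, ⋂ (_ : i ∉ τ), {μ : I → ℝ | μ i = 0}) ∩
      {μ | ∑ i ∈ τ, μ i = 1} := by
    ext μ; simp [Dl, and_assoc]
  rw [this]
  refine (IsClosed.inter (isClosed_iInter fun i => ?_) (isClosed_iInter fun i => isClosed_iInter
    fun _ => ?_)).inter ?_
  · exact isClosed_le continuous_const (continuous_apply i)
  · exact isClosed_eq (continuous_apply i) continuous_const
  · exact isClosed_eq (by fun_prop) continuous_const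

lemma Dl_le_one {τ : Finset I} {μ : I → ℝ} (h : μ ∈ Dl τ) (i : I) : μ i ≤ 1 := by
  classical
  by_cases hi : i ∈ τ
  · rw [← h.2.2]
    exact Finset.single_le_sum (fun j _ => h.1 j) hi
  · rw [h.2.1 i hi]; exact zero_le_one

lemma isCompact_Dl (τ : Finset I) : IsCompact (Dl τ) := by
  refine IsCompact.of_isClosed_subset
    (isCompact_univ_pi (s := fun _ : I => Set.Icc (0 : ℝ) 1) fun _ => isCompact_Icc)
    (isClosed_Dl τ) ?_
  intro μ h i _
  exact ⟨h.1 i, Dl_le_one h i⟩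

lemma isClosed_Bd (τ : Finset I) : IsClosed (Bd τ) := by
  have : Bd τ = Dl τ ∩ ⋃ i ∈ τ, {μ : I → ℝ | μ i = 0} := by
    ext μ; simp [Bd]
  rw [this]
  exact (isClosed_Dl τ).inter (Set.Finite.isClosed_biUnion τ.finite_toSet fun i _ =>
    isClosed_eq (continuous_apply i) continuous_const)

lemma isCompact_Bd (τ : Finset I) : IsCompact (Bd τ) :=
  (isCompact_Dl τ).of_isClosed_subset (isClosed_Bd τ) fun _ h => h.1

end Simp

section VN
variable {H : Type*} [NormedAddCommGroup H] [InnerProductSpace ℂ H] [CompleteSpace H]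

lemma ext_vn {M : VonNeumannAlgebra H} (hM : PInf M) {I : Type*} (τ : Finset I)
    (f : (I → ℝ) → H →L[ℂ] H) (hf : ContinuousOn f (Bd τ)) (hfU : ∀ μ ∈ Bd τ, IsU M (f μ)) :
    ∃ g : (I → ℝ) → H →L[ℂ] H, ContinuousOn g (Dl τ) ∧ (∀ μ ∈ Dl τ, IsU M (g μ)) ∧
      ∀ μ ∈ Bd τ, g μ = f μ := by
  classical
  rcases τ.eq_empty_or_nonempty with rfl | hτ
  · have : Dl (∅ : Finset I) = ∅ := by ext μ; simp [Dl]
    exact ⟨f, by simp [this], by simp [this], fun _ _ => rfl⟩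
  obtain ⟨F, hFc, hFU, hF0, hF1⟩ := kuiper_on hM (isCompact_Bd τ) f hf hfU
  let m : (I → ℝ) → ℝ := fun μ => τ.inf' hτ μ
  have hmc : Continuous m := Continuous.finset_inf'_apply hτ fun i _ => continuous_apply i
  let t : (I → ℝ) → ℝ := fun μ => τ.card * m μ
  have htc : Continuous t := by fun_prop
  let ν : (I → ℝ) → I → ℝ := fun μ i => (1 - t μ)⁻¹ * (if i ∈ τ then μ i - m μ else 0)
  have hm0 : ∀ μ ∈ Dl τ, 0 ≤ m μ := fun μ hμ => Finset.le_inf' _ _ fun i _ => hμ.1 i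
  have ht0 : ∀ μ ∈ Dl τ, 0 ≤ t μ := fun μ hμ => mul_nonneg (Nat.cast_nonneg _) (hm0 μ hμ)
  have hmi : ∀ μ : I → ℝ, ∀ i ∈ τ, m μ ≤ μ i := fun μ i hi => Finset.inf'_le _ hi
  have hν : ∀ μ ∈ Dl τ, t μ ≤ 1 / 2 → ν μ ∈ Bd τ := by
    intro μ hμ ht
    have h1 : 0 < 1 - t μ := by linarith
    refine ⟨⟨fun i => ?_, fun i hi => ?_, ?_⟩, ?_⟩
    · by_cases hi : i ∈ τ
      · simp only [ν, hi, if_true]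
        exact mul_nonneg (inv_nonneg.2 h1.le) (sub_nonneg.2 (hmi μ i hi))
      · simp [ν, hi]
    · simp [ν, hi]
    · simp only [ν]
      rw [← Finset.mul_sum, Finset.sum_congr rfl (g := fun i => μ i - m μ)
        (fun i hi => by simp [hi]), Finset.sum_sub_distrib, hμ.2.2, Finset.sum_const, nsmul_eq_mul]
      exact inv_mul_cancel₀ h1.ne'
    · obtain ⟨i, hi, hi'⟩ := Finset.exists_mem_eq_inf' hτ μ
      refine ⟨i, hi, ?_⟩
      have : m μ = μ i := hi'
      simp [ν, hi, this]
  have hνb : ∀ μ ∈ Bd τ, t μ = 0 ∧ ν μ = μ := by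
    rintro μ ⟨hμ, i, hi, hi0⟩
    have h1 : m μ = 0 := le_antisymm (hi0 ▸ hmi μ i hi) (hm0 μ hμ)
    have h2 : t μ = 0 := by simp [t, h1]
    refine ⟨h2, ?_⟩
    ext j
    by_cases hj : j ∈ τ
    · simp [ν, h1, h2, hj]
    · simp [ν, hj, hμ.2.1 j hj]
  have hνc : ContinuousOn ν {μ | t μ ≤ 1 / 2} := by
    refine continuousOn_pi.2 fun i => ?_
    refine ContinuousOn.mul (ContinuousOn.inv₀ (by fun_prop) ?_) ?_
    · intro μ hμ
      have : t μ ≤ 1 / 2 := hμ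
      linarith
    · by_cases hi : i ∈ τ
      · simp only [hi, if_true]; fun_prop
      · simp only [hi, if_false]; fun_prop
  let g : (I → ℝ) → H →L[ℂ] H := fun μ => if t μ ≤ 1 / 2 then F (2 * t μ, ν μ) else 1
  have hin : ∀ μ ∈ Dl τ, t μ ≤ 1 / 2 → (2 * t μ, ν μ) ∈ Set.Icc (0 : ℝ) 1 ×ˢ Bd τ := by
    intro μ hμ ht
    have := ht0 μ hμ
    exact ⟨⟨by simp only; linarith, by simp only; linarith⟩, hν μ hμ ht⟩
  refine ⟨g, ?_, ?_, ?_⟩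
  · have e : Dl τ = (Dl τ ∩ {μ | t μ ≤ 1 / 2}) ∪ (Dl τ ∩ {μ | 1 / 2 ≤ t μ}) := by
      ext μ
      constructor
      · intro h
        rcases le_total (t μ) (1 / 2) with h' | h'
        · exact Or.inl ⟨h, h'⟩
        · exact Or.inr ⟨h, h'⟩
      · rintro (h | h) <;> exact h.1
    rw [e]
    refine ContinuousOn.union_of_isClosed ?_ ?_
      ((isClosed_Dl τ).inter (isClosed_le htc continuous_const))
      ((isClosed_Dl τ).inter (isClosed_le continuous_const htc))
    · have h1 : ContinuousOn (fun μ => F (2 * t μ, ν μ)) (Dl τ ∩ {μ | t μ ≤ 1 / 2}) := by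
        refine hFc.comp (ContinuousOn.prodMk (by fun_prop) (hνc.mono Set.inter_subset_right)) ?_
        intro μ hμ
        exact hin μ hμ.1 hμ.2
      refine h1.congr fun μ hμ => ?_
      have : t μ ≤ 1 / 2 := hμ.2
      simp only [g, this, if_true]
    · refine (continuousOn_const (c := (1 : H →L[ℂ] H))).congr fun μ hμ => ?_
      have h1 : 1 / 2 ≤ t μ := hμ.2
      simp only [g]
      split_ifs with h
      · have h2 : 2 * t μ = 1 := by linarith
        rw [h2]
        exact hF1 _ (hν μ hμ.1 h)
      · rfl
  · intro μ hμ
    simp only [g]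
    split_ifs with h
    · exact hFU _ (hin μ hμ h)
    · exact IsU.one M
  · intro μ hμ
    obtain ⟨h1, h2⟩ := hνb μ hμ
    simp only [g, h1, h2]
    norm_num
    exact hF0 μ hμ

end VN
end UOC

set_option linter.unusedSimpArgs false
set_option linter.unusedVariables false
namespace UOC
section Simp
variable {I : Type*}

lemma contOn_biUnion {X Y ι : Type*} [TopologicalSpace X] [TopologicalSpace Y] (s : Finset ι)
    (C : ι → Set X) (hC : ∀ i ∈ s, IsClosed (C i)) (f : X → Y)
    (hf : ∀ i ∈ s, ContinuousOn f (C i)) : ContinuousOn f (⋃ i ∈ s, C i) := by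
  classical
  induction s using Finset.induction_on with
  | empty => simp
  | insert i s hi ih =>
    rw [Finset.set_biUnion_insert]
    exact ContinuousOn.union_of_isClosed (hf i (by simp))
      (ih (fun j hj => hC j (by simp [hj])) fun j hj => hf j (by simp [hj]))
      (hC i (by simp)) (s.finite_toSet.isClosed_biUnion fun j hj => hC j
        (by simp at hj; simp [hj]))

lemma Dl_mono {σ τ : Finset I} (h : σ ⊆ τ) : Dl σ ⊆ Dl τ := by
  intro μ hμ
  refine ⟨hμ.1, fun i hi => hμ.2.1 i fun h' => hi (h h'), ?_⟩
  rw [← hμ.2.2]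
  exact (Finset.sum_subset h fun i _ hi => hμ.2.1 i hi).symm

lemma Dl_restrict {σ τ : Finset I} (h : σ ⊆ τ) {μ : I → ℝ} (hμ : μ ∈ Dl τ)
    (h0 : ∀ i ∈ τ, i ∉ σ → μ i = 0) : μ ∈ Dl σ := by
  refine ⟨hμ.1, fun i hi => ?_, ?_⟩
  · by_cases hi' : i ∈ τ
    · exact h0 i hi' hi
    · exact hμ.2.1 i hi'
  · rw [← hμ.2.2]
    exact Finset.sum_subset h h0

lemma Bd_eq [DecidableEq I] (τ : Finset I) : Bd τ = ⋃ i ∈ τ, Dl (τ.erase i) := by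
  ext μ
  simp only [Set.mem_iUnion]
  constructor
  · rintro ⟨h, i, hi, hi0⟩
    refine ⟨i, hi, Dl_restrict (Finset.erase_subset _ _) h fun j hj hj' => ?_⟩
    have : j = i := by
      by_contra hne
      exact hj' (Finset.mem_erase.2 ⟨hne, hj⟩)
    rw [this, hi0]
  · rintro ⟨i, hi, h⟩
    exact ⟨Dl_mono (Finset.erase_subset _ _) h, i, hi, h.2.1 i (by simp)⟩

/-- relative interior of a simplex -/
def In (τ : Finset I) : Set (I → ℝ) := {μ | μ ∈ Dl τ ∧ μ ∉ Bd τ}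

lemma In_ne {τ : Finset I} {μ : I → ℝ} (h : μ ∈ In τ) (i : I) : i ∈ τ ↔ μ i ≠ 0 :=
  ⟨fun hi h0 => h.2 ⟨h.1, i, hi, h0⟩, fun h0 => by
    by_contra hi
    exact h0 (h.1.2.1 i hi)⟩

lemma In_unique {σ τ : Finset I} {μ : I → ℝ} (h : μ ∈ In σ) (h' : μ ∈ In τ) : σ = τ := by
  ext i; rw [In_ne h, In_ne h']

lemma In_subset {σ τ : Finset I} {μ : I → ℝ} (h : μ ∈ In σ) (h' : μ ∈ Dl τ) : σ ⊆ τ := by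
  intro i hi
  by_contra hi'
  exact (In_ne h i).1 hi (h'.2.1 i hi')

lemma exists_In [DecidableEq I] {τ : Finset I} {μ : I → ℝ} (h : μ ∈ Dl τ) :
    ∃ σ, σ ⊆ τ ∧ μ ∈ In σ := by
  refine ⟨τ.filter fun i => μ i ≠ 0, Finset.filter_subset _ _, ?_, ?_⟩
  · exact Dl_restrict (Finset.filter_subset _ _) h fun i hi hi' => by
      by_contra h0
      exact hi' (Finset.mem_filter.2 ⟨hi, h0⟩)
  · rintro ⟨-, i, hi, hi0⟩
    exact (Finset.mem_filter.1 hi).2 hi0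

lemma global_section {Y : Type*} [TopologicalSpace Y] [Nonempty Y] (K : Set (Finset I))
    (hK : ∀ τ ∈ K, ∀ σ, σ ⊆ τ → σ ∈ K) (F : (I → ℝ) → Set Y)
    (hext : ∀ τ ∈ K, ∀ f : (I → ℝ) → Y, ContinuousOn f (Bd τ) → (∀ μ ∈ Bd τ, f μ ∈ F μ) →
      ∃ g : (I → ℝ) → Y, ContinuousOn g (Dl τ) ∧ (∀ μ ∈ Dl τ, g μ ∈ F μ) ∧
        ∀ μ ∈ Bd τ, g μ = f μ) :
    ∃ G : (I → ℝ) → Y, ∀ τ ∈ K, ContinuousOn G (Dl τ) ∧ ∀ μ ∈ Dl τ, G μ ∈ F μ := by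
  classical
  let Good : ℕ → ((I → ℝ) → Y) → Prop := fun n G =>
    ∀ τ ∈ K, τ.card ≤ n → ContinuousOn G (Dl τ) ∧ ∀ μ ∈ Dl τ, G μ ∈ F μ
  have step : ∀ n G, Good n G → ∃ G', Good (n + 1) G' ∧
      ∀ τ ∈ K, τ.card ≤ n → ∀ μ ∈ Dl τ, G' μ = G μ := by
    intro n G hG
    have hg : ∀ τ : Finset I, ∃ g : (I → ℝ) → Y, τ ∈ K → τ.card = n + 1 →
        ContinuousOn g (Dl τ) ∧ (∀ μ ∈ Dl τ, g μ ∈ F μ) ∧ ∀ μ ∈ Bd τ, g μ = G μ := by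
      intro τ
      by_cases h : τ ∈ K ∧ τ.card = n + 1
      · have hb : ∀ i ∈ τ, ContinuousOn G (Dl (τ.erase i)) ∧ ∀ μ ∈ Dl (τ.erase i), G μ ∈ F μ :=
          fun i hi => hG _ (hK τ h.1 _ (Finset.erase_subset _ _)) (by
            rw [Finset.card_erase_of_mem hi, h.2]; simp)
        obtain ⟨g, hg⟩ := hext τ h.1 G (by
          rw [Bd_eq]
          exact contOn_biUnion τ _ (fun i _ => isClosed_Dl _) G fun i hi => (hb i hi).1) (by
          intro μ hμ
          rw [Bd_eq] at hμ
          obtain ⟨i, hi, hμ⟩ := Set.mem_iUnion₂.1 hμ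
          exact (hb i hi).2 μ hμ)
        exact ⟨g, fun _ _ => hg⟩
      · exact ⟨G, fun h1 h2 => absurd ⟨h1, h2⟩ h⟩
    choose g hg using hg
    let G' : (I → ℝ) → Y := fun μ =>
      if h : ∃ τ, τ ∈ K ∧ τ.card = n + 1 ∧ μ ∈ In τ then g h.choose μ else G μ
    have hlow : ∀ τ ∈ K, τ.card ≤ n → ∀ μ ∈ Dl τ, G' μ = G μ := by
      intro τ hτ hc μ hμ
      have : ¬ ∃ τ, τ ∈ K ∧ τ.card = n + 1 ∧ μ ∈ In τ := by
        rintro ⟨σ, _, hσ, hσμ⟩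
        have := Finset.card_le_card (In_subset hσμ hμ)
        omega
      simp only [G', dif_neg this]
    have htop : ∀ τ ∈ K, τ.card = n + 1 → ∀ μ ∈ Dl τ, G' μ = g τ μ := by
      intro τ hτ hc μ hμ
      by_cases hμb : μ ∈ Bd τ
      · rw [(hg τ hτ hc).2.2 μ hμb]
        rw [Bd_eq] at hμb
        obtain ⟨i, hi, hμ'⟩ := Set.mem_iUnion₂.1 hμb
        exact hlow _ (hK τ hτ _ (Finset.erase_subset _ _)) (by
            rw [Finset.card_erase_of_mem hi, hc]; simp) μ hμ'
      · have h : ∃ τ, τ ∈ K ∧ τ.card = n + 1 ∧ μ ∈ In τ := ⟨τ, hτ, hc, hμ, hμb⟩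
        have h2 : h.choose = τ := In_unique h.choose_spec.2.2 ⟨hμ, hμb⟩
        simp only [G', dif_pos h, h2]
    refine ⟨G', ?_, hlow⟩
    intro τ hτ hc
    rcases Nat.lt_or_eq_of_le hc with hc | hc
    · have hc' : τ.card ≤ n := by omega
      refine ⟨(hG τ hτ hc').1.congr fun μ hμ => hlow τ hτ hc' μ hμ, fun μ hμ => ?_⟩
      rw [hlow τ hτ hc' μ hμ]
      exact (hG τ hτ hc').2 μ hμ
    · refine ⟨(hg τ hτ hc).1.congr fun μ hμ => htop τ hτ hc μ hμ, fun μ hμ => ?_⟩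
      rw [htop τ hτ hc μ hμ]
      exact (hg τ hτ hc).2.1 μ hμ
  choose nx hnx1 hnx2 using step
  have h0 : Good 0 (fun _ => Classical.arbitrary Y) := by
    intro τ hτ hc
    have : τ = ∅ := Finset.card_eq_zero.1 (Nat.le_zero.1 hc)
    subst this
    have : Dl (∅ : Finset I) = ∅ := by ext μ; simp [Dl]
    simp [this]
  let S : (n : ℕ) → {G : (I → ℝ) → Y // Good n G} := fun n =>
    Nat.rec (motive := fun n => {G : (I → ℝ) → Y // Good n G}) ⟨_, h0⟩
      (fun n G => ⟨nx n G.1 G.2, hnx1 n G.1 G.2⟩) n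
  have hS : ∀ n, ∀ τ ∈ K, τ.card ≤ n → ∀ μ ∈ Dl τ, (S (n + 1)).1 μ = (S n).1 μ :=
    fun n => hnx2 n (S n).1 (S n).2
  have hS' : ∀ k n, ∀ τ ∈ K, τ.card ≤ n → ∀ μ ∈ Dl τ, (S (n + k)).1 μ = (S n).1 μ := by
    intro k n τ hτ hc μ hμ
    induction k with
    | zero => rfl
    | succ k ih => rw [← ih]; exact hS (n + k) τ hτ (by omega) μ hμ
  let G : (I → ℝ) → Y := fun μ => if h : ∃ σ, μ ∈ In σ then (S h.choose.card).1 μ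
    else Classical.arbitrary Y
  have hG : ∀ τ ∈ K, ∀ μ ∈ Dl τ, G μ = (S τ.card).1 μ := by
    intro τ hτ μ hμ
    obtain ⟨σ, hστ, hσ⟩ := exists_In hμ
    have h : ∃ σ, μ ∈ In σ := ⟨σ, hσ⟩
    have h2 : h.choose = σ := In_unique h.choose_spec hσ
    have h3 : G μ = (S h.choose.card).1 μ := dif_pos h
    obtain ⟨k, hk⟩ := Nat.exists_eq_add_of_le (Finset.card_le_card hστ)
    rw [h3, h2, hk]
    exact (hS' k σ.card σ (hK τ hτ σ hστ) le_rfl μ hσ.1).symm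
  refine ⟨G, fun τ hτ => ?_⟩
  have h := (S τ.card).2 τ hτ le_rfl
  refine ⟨h.1.congr fun μ hμ => hG τ hτ μ hμ, fun μ hμ => ?_⟩
  rw [hG τ hτ μ hμ]
  exact h.2 μ hμ

end Simp
end UOC

set_option linter.unusedSimpArgs false
set_option linter.unusedVariables false
namespace UOC
section VN
variable {H : Type*} [NormedAddCommGroup H] [InnerProductSpace ℂ H] [CompleteSpace H]

lemma exists_relcomm (M : VonNeumannAlgebra H) (p : H →L[ℂ] H) (hps : star p = p) :
    ∃ N : VonNeumannAlgebra H, ∀ x, x ∈ N ↔ x ∈ M ∧ x * p = p * x := by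
  refine ⟨⟨StarSubalgebra.centralizer ℂ ((M.commutant : Set (H →L[ℂ] H)) ∪ {p}), ?_⟩, fun x => ?_⟩
  · simp
  · change x ∈ StarSubalgebra.centralizer ℂ ((M.commutant : Set (H →L[ℂ] H)) ∪ {p}) ↔ _
    rw [StarSubalgebra.mem_centralizer_iff]
    constructor
    · intro h
      exact ⟨mem_of_comm M x fun y hy => (h y (Or.inl hy)).1, (h p (Or.inr rfl)).1.symm⟩
    · rintro ⟨h1, h2⟩ g (hg | hg)
      · exact ⟨(comm_of_mem h1 hg).symm, (comm_of_mem h1 (star_mem hg)).symm⟩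
      · rw [Set.mem_singleton_iff.1 hg, hps]; exact ⟨h2.symm, h2.symm⟩

lemma pinf_aux {M : VonNeumannAlgebra H} {p : H →L[ℂ] H} (hp : p * p = p) (hps : star p = p)
    {v : H →L[ℂ] H} (hv : star v * v = p) (hv' : v * star v ≤ p) : v * p = v ∧ p * v = v := by
  constructor
  · have h : star (v * (1 - p)) * (v * (1 - p)) = 0 := by
      rw [star_mul, mul_assoc, ← mul_assoc (star v), hv]
      simp [mul_sub, sub_mul, hp, hps]
    have := (CStarRing.star_mul_self_eq_zero_iff _).1 h
    rw [mul_sub, mul_one, sub_eq_zero] at this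
    exact this.symm
  · have h1 := star_left_conjugate_le_conjugate hv' (1 - p)
    have e1 : star (1 - p) * p * (1 - p) = 0 := by simp [mul_sub, sub_mul, hp, hps]
    have e2 : star (1 - p) * (v * star v) * (1 - p) = ((1 - p) * v) * star ((1 - p) * v) := by
      simp only [star_mul, star_sub, star_one, hps, mul_assoc]
    rw [e1, e2] at h1
    have h2 := le_antisymm h1 (mul_star_self_nonneg _)
    have := (CStarRing.mul_star_self_eq_zero_iff _).1 h2
    rw [sub_mul, one_mul, sub_eq_zero] at this
    exact this.symm

lemma pinf_relcomm {M N : VonNeumannAlgebra H} {p : H →L[ℂ] H} (hp : p * p = p) (hps : star p = p)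
    (hN : ∀ x, x ∈ N ↔ x ∈ M ∧ x * p = p * x)
    (h1 : IsProperlyInfiniteProj M p) (h2 : IsProperlyInfiniteProj M (1 - p)) : PInf N := by
  obtain ⟨v, hvM, w, hwM, hv, hw, hv', hw', hvw⟩ := h1
  obtain ⟨x, hxM, y, hyM, hx, hy, hx', hy', hxy⟩ := h2
  set c := 1 - p with hc
  have hcc : c * c = c := by simp [hc, mul_sub, sub_mul, hp]
  have hcs : star c = c := by simp [hc, hps]
  have hpc : p * c = 0 := by simp [hc, mul_sub, hp]
  have hcp : c * p = 0 := by simp [hc, sub_mul, hp]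
  obtain ⟨v1, v2⟩ := pinf_aux (M := M) hp hps hv hv'
  obtain ⟨w1, w2⟩ := pinf_aux (M := M) hp hps hw hw'
  obtain ⟨x1, x2⟩ := pinf_aux (M := M) hcc hcs hx hx'
  obtain ⟨y1, y2⟩ := pinf_aux (M := M) hcc hcs hy hy'
  have sv : p * star v = star v := by simpa [hps] using congrArg star v1
  have sv' : star v * p = star v := by simpa [hps] using congrArg star v2
  have sw' : star w * p = star w := by simpa [hps] using congrArg star w2
  have sx : c * star x = star x := by simpa [hcs] using congrArg star x1
  have sx' : star x * c = star x := by simpa [hcs] using congrArg star x2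
  have sy' : star y * c = star y := by simpa [hcs] using congrArg star y2
  have key : ∀ a b : H →L[ℂ] H, star a * p = star a → c * b = b → star a * b = 0 := by
    intro a b ha hb
    rw [← ha, ← hb, mul_assoc, ← mul_assoc p, hpc, zero_mul, mul_zero]
  have key' : ∀ a b : H →L[ℂ] H, star a * c = star a → p * b = b → star a * b = 0 := by
    intro a b ha hb
    rw [← ha, ← hb, mul_assoc, ← mul_assoc c, hcp, zero_mul, mul_zero]
  have orth : star v * w = 0 := by
    have : star v * w = star v * ((v * star v) * (w * star w)) * w := by
      calc star v * w = (p * star v) * (w * p) := by rw [sv, w1]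
        _ = (star v * v * star v) * (w * (star w * w)) := by rw [hv, hw]
        _ = _ := by simp only [mul_assoc]
    rw [this, hvw]; simp
  have orth' : star x * y = 0 := by
    have : star x * y = star x * ((x * star x) * (y * star y)) * y := by
      calc star x * y = (c * star x) * (y * c) := by rw [sx, y1]
        _ = (star x * x * star x) * (y * (star y * y)) := by rw [hx, hy]
        _ = _ := by simp only [mul_assoc]
    rw [this, hxy]; simp
  have z1 : ∀ a : H →L[ℂ] H, a * c = a → a * p = 0 := by
    intro a ha; rw [← ha, mul_assoc, hcp, mul_zero]
  have z2 : ∀ a : H →L[ℂ] H, c * a = a → p * a = 0 := by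
    intro a ha; rw [← ha, ← mul_assoc, hpc, zero_mul]
  refine ⟨v + x, (hN _).2 ⟨add_mem hvM hxM, ?_⟩, w + y, (hN _).2 ⟨add_mem hwM hyM, ?_⟩, ?_, ?_, ?_⟩
  · rw [add_mul, mul_add, v1, v2, z1 x x1, z2 x x2]
  · rw [add_mul, mul_add, w1, w2, z1 y y1, z2 y y2]
  · rw [star_add, add_mul, mul_add, mul_add, hv, hx, key v x sv' x2, key' x v sx' v2, hc]; abel
  · rw [star_add, add_mul, mul_add, mul_add, hw, hy, key w y sw' y2, key' y w sy' w2, hc]; abel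
  · rw [star_add, add_mul, mul_add, mul_add, orth, orth', key v y sv' y2, key' x w sx' w2]; simp

end VN
end UOC

set_option linter.unusedSimpArgs false
set_option linter.unusedVariables false
namespace UOC
section VN
variable {H : Type*} [NormedAddCommGroup H] [InnerProductSpace ℂ H] [CompleteSpace H]

/-- projections -/
def IsPr (q : H →L[ℂ] H) : Prop := q * q = q ∧ star q = q

/-- symmetry of a projection -/
def sy (a : H →L[ℂ] H) : H →L[ℂ] H := a + a - 1

lemma sy_star {a : H →L[ℂ] H} (ha : star a = a) : star (sy a) = sy a := by simp [sy, ha]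

lemma sy_mul {q : H →L[ℂ] H} (hq : IsPr q) : sy q * sy q = 1 := by
  simp only [sy, mul_sub, sub_mul, mul_add, add_mul, hq.1, mul_one, one_mul]; abel

lemma sy_iso {q : H →L[ℂ] H} (hq : IsPr q) : star (sy q) * sy q = 1 := by
  rw [sy_star hq.2, sy_mul hq]

lemma sy_norm {q : H →L[ℂ] H} (hq : IsPr q) : ‖sy q‖ ≤ 1 := iso_norm (sy_iso hq)

/-- the intertwiner of two close projections -/
def sw (q q' : H →L[ℂ] H) : H →L[ℂ] H := q * q' + (1 - q) * (1 - q')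

lemma isUnit_of_near {x : H →L[ℂ] H} (h : ‖x - 1‖ < 1) : IsUnit x := by
  have := isUnit_one_sub_of_norm_lt_one (x := 1 - x) (by rwa [norm_sub_rev])
  simpa using this

lemma sw_unit {q q' : H →L[ℂ] H} (hq : IsPr q) (hq' : IsPr q') (h : ‖q' - q‖ < 1) :
    IsUnit (sw q q') := by
  apply isUnit_of_near
  have e : sw q q' - 1 = sy q * (q' - q) := by
    simp only [sw, sy, mul_sub, sub_mul, mul_add, add_mul, hq.1, mul_one, one_mul]; abel
  rw [e]
  calc _ ≤ ‖sy q‖ * ‖q' - q‖ := norm_mul_le _ _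
    _ ≤ 1 * ‖q' - q‖ := by gcongr; exact sy_norm hq
    _ < 1 := by simpa using h

lemma sw_mem {M : VonNeumannAlgebra H} {q q' : H →L[ℂ] H} (hq : q ∈ M) (hq' : q' ∈ M) :
    sw q q' ∈ M :=
  add_mem (mul_mem hq hq') (mul_mem (sub_mem (one_mem M) hq) (sub_mem (one_mem M) hq'))

lemma sw_conj {q q' : H →L[ℂ] H} (hq : IsPr q) (hq' : IsPr q') (h : ‖q' - q‖ < 1) :
    pol (sw q q') * q' * star (pol (sw q q')) = q := by
  have h1 : pol (sw q q') * q' = q * pol (sw q q') := by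
    refine pol_intertwine hq.2 hq'.2 ?_
    simp only [sw, mul_sub, sub_mul, mul_add, add_mul, mul_one, one_mul, mul_assoc, hq'.1]
    simp only [← mul_assoc, hq.1]
    abel
  rw [h1, mul_assoc, pol_right (sw_unit hq hq' h), mul_one]

/-- the orbit -/
def Orb (M : VonNeumannAlgebra H) (p : H →L[ℂ] H) : Set (H →L[ℂ] H) :=
  {q | ∃ u, IsU M u ∧ q = u * p * star u}

lemma Orb_pr {M : VonNeumannAlgebra H} {p q : H →L[ℂ] H} (hp : IsPr p) (hq : q ∈ Orb M p) :
    IsPr q := by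
  obtain ⟨u, hu, rfl⟩ := hq
  constructor
  · calc u * p * star u * (u * p * star u) = u * p * (star u * u) * p * star u := by
          simp only [mul_assoc]
      _ = u * (p * p) * star u := by rw [hu.2.1]; simp only [mul_assoc, mul_one, one_mul]
      _ = _ := by rw [hp.1]
  · simp [hp.2, mul_assoc]

lemma Orb_mem {M : VonNeumannAlgebra H} {p q : H →L[ℂ] H} (hp : p ∈ M) (hq : q ∈ Orb M p) :
    q ∈ M := by
  obtain ⟨u, hu, rfl⟩ := hq
  exact mul_mem (mul_mem hu.1 hp) (star_mem hu.1)

lemma Orb_conj {M : VonNeumannAlgebra H} {p q u : H →L[ℂ] H} (hq : q ∈ Orb M p) (hu : IsU M u) :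
    u * q * star u ∈ Orb M p := by
  obtain ⟨u', hu', rfl⟩ := hq
  exact ⟨u * u', hu.mul hu', by simp only [star_mul, mul_assoc]⟩

/-- retraction to projections -/
noncomputable def Er (a : H →L[ℂ] H) : H →L[ℂ] H := (1 / 2 : ℝ) • (1 + pol (sy a))

lemma half_add (x : H →L[ℂ] H) : (1 / 2 : ℝ) • (x + x) = x := by
  rw [← two_smul ℝ x, smul_smul]; norm_num

lemma Er_eq {q : H →L[ℂ] H} (hq : IsPr q) : Er q = q := by
  rw [Er, pol_unitary (sy_iso hq)]
  have : 1 + sy q = q + q := by simp [sy]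
  rw [this, half_add]

lemma Er_cont : ContinuousOn (Er (H := H)) {a | IsUnit (sy a)} := by
  have h1 : Continuous (sy (H := H)) := by unfold sy; fun_prop
  have h2 : ContinuousOn (fun a : H →L[ℂ] H => pol (sy a)) {a | IsUnit (sy a)} :=
    pol_cont.comp h1.continuousOn fun a ha => ha
  exact (continuousOn_const.add h2).const_smul (1 / 2 : ℝ)

lemma Er_pr {a : H →L[ℂ] H} (ha : star a = a) (hu : IsUnit (sy a)) : IsPr (Er a) := by
  have h1 := pol_sa (sy_star ha)
  have h2 := pol_left hu
  rw [h1] at h2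
  constructor
  · rw [Er, smul_mul_smul_comm]
    simp only [mul_add, add_mul, mul_one, one_mul, h2]
    have : 1 + pol (sy a) + (pol (sy a) + 1) = (1 + pol (sy a)) + (1 + pol (sy a)) := by abel
    rw [this, ← two_smul ℝ (1 + pol (sy a)), smul_smul]; norm_num
  · rw [Er, star_smul, star_add, h1]; simp

lemma exists_eta : ∃ η : ℝ, 0 < η ∧ ∀ (M : VonNeumannAlgebra H) (p q a : H →L[ℂ] H), IsPr p →
    p ∈ M → q ∈ Orb M p → a ∈ M → star a = a → ‖a - q‖ < η →
    IsUnit (sy a) ∧ Er a ∈ Orb M p ∧ ‖q - Er a‖ < 1 := by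
  have hc : ContinuousAt (pol (H := H)) 1 :=
    pol_cont.continuousAt (Units.isOpen.mem_nhds isUnit_one)
  obtain ⟨δ, hδ, h⟩ := Metric.continuousAt_iff.1 hc 1 one_pos
  refine ⟨min δ 1 / 2, by positivity, ?_⟩
  intro M p q a hp hpM hq haM hsa hn
  have hqp := Orb_pr hp hq
  set r := sy q with hr
  have hrr : r * r = 1 := sy_mul hqp
  have hx : ‖r * sy a - 1‖ < min δ 1 := by
    have e : r * sy a - 1 = r * ((a - q) + (a - q)) := by
      rw [← hrr, ← mul_sub, hr]; congr 1; simp only [sy]; abel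
    rw [e]
    calc _ ≤ ‖r‖ * ‖(a - q) + (a - q)‖ := norm_mul_le _ _
      _ ≤ 1 * (‖a - q‖ + ‖a - q‖) := by gcongr; exacts [sy_norm hqp, norm_add_le _ _]
      _ < _ := by linarith
  have hu1 : IsUnit (r * sy a) := isUnit_of_near (hx.trans_le (min_le_right _ _))
  have hsya : sy a = r * (r * sy a) := by rw [← mul_assoc, hrr, one_mul]
  have hru : IsUnit r := isUnit_iff_exists.2 ⟨r, hrr, hrr⟩
  have hu : IsUnit (sy a) := by rw [hsya]; exact hru.mul hu1
  have hpol : ‖pol (r * sy a) - 1‖ < 1 := by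
    have := h (x := r * sy a) (by rw [dist_eq_norm]; exact hx.trans_le (min_le_left _ _))
    rwa [pol_one, dist_eq_norm] at this
  have hE : ‖q - Er a‖ < 1 := by
    have e : q - Er a = (1 / 2 : ℝ) • (r * (1 - pol (r * sy a))) := by
      rw [mul_sub, mul_one, ← pol_mul (sy_iso hqp), ← hr, ← hsya, Er]
      conv_lhs => rw [← half_add q]
      rw [← smul_sub]; congr 1; rw [hr]; simp only [sy]; abel
    rw [e, norm_smul]
    have : ‖r * (1 - pol (r * sy a))‖ ≤ 1 * ‖1 - pol (r * sy a)‖ :=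
      (norm_mul_le _ _).trans (by gcongr; exact sy_norm hqp)
    rw [norm_sub_rev] at hpol
    norm_num
    linarith
  refine ⟨hu, ?_, hE⟩
  have hEp := Er_pr hsa hu
  have hEM : Er a ∈ M := rsmul_mem' (add_mem (one_mem M)
    (pol_mem (sub_mem (add_mem haM haM) (one_mem M)))) _
  rw [← sw_conj hEp hqp hE]
  exact Orb_conj hq (isU_pol (sw_mem hEM (Orb_mem hpM hq)) (sw_unit hEp hqp hE))

end VN
end UOC

set_option linter.unusedSimpArgs false
set_option linter.unusedVariables false
namespace UOC
section VN
variable {H : Type*} [NormedAddCommGroup H] [InnerProductSpace ℂ H] [CompleteSpace H]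

/-- vertex positions -/
def cc (O : Set (H →L[ℂ] H)) : Option O → H →L[ℂ] H
  | none => 0
  | some q => q

/-- the affine extension of the vertex map -/
noncomputable def av (O : Set (H →L[ℂ] H)) (μ : Option O → ℝ) : H →L[ℂ] H := ∑ᶠ i, μ i • cc O i

lemma av_eq {O : Set (H →L[ℂ] H)} {τ : Finset (Option O)} {μ : Option O → ℝ} (h : μ ∈ Dl τ) :
    av O μ = ∑ i ∈ τ, μ i • cc O i := by
  refine finsum_eq_sum_of_support_subset _ ?_
  intro i hi
  by_contra h'
  exact hi (by simp [h.2.1 i h'])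

lemma av_cont (O : Set (H →L[ℂ] H)) (τ : Finset (Option O)) : ContinuousOn (av O) (Dl τ) := by
  have : Continuous fun μ : Option O → ℝ => ∑ i ∈ τ, μ i • cc O i := by fun_prop
  exact this.continuousOn.congr fun μ hμ => av_eq hμ

lemma av_ball {O : Set (H →L[ℂ] H)} {τ : Finset (Option O)} {μ : Option O → ℝ} (h : μ ∈ Dl τ)
    {x : H →L[ℂ] H} {η : ℝ} (hb : ∀ i, μ i ≠ 0 → ‖cc O i - x‖ < η) : ‖av O μ - x‖ < η := by
  classical
  obtain ⟨σ, hσ, hi⟩ := exists_In h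
  rw [av_eq hi.1]
  have := Convex.sum_mem (convex_ball x η) (t := σ) (w := μ) (z := cc O) (fun i _ => h.1 i)
    hi.1.2.2 (fun i hi' => by rw [mem_ball_iff_norm]; exact hb i ((In_ne hi i).1 hi'))
  rwa [mem_ball_iff_norm] at this

lemma av_mem {M : VonNeumannAlgebra H} {O : Set (H →L[ℂ] H)} (hO : ∀ q ∈ O, q ∈ M)
    {τ : Finset (Option O)} {μ : Option O → ℝ} (h : μ ∈ Dl τ) : av O μ ∈ M := by
  rw [av_eq h]
  refine sum_mem fun i _ => rsmul_mem' ?_ _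
  cases i with
  | none => exact zero_mem M
  | some q => exact hO q q.2

lemma av_sa {O : Set (H →L[ℂ] H)} (hO : ∀ q ∈ O, star q = q)
    {τ : Finset (Option O)} {μ : Option O → ℝ} (h : μ ∈ Dl τ) : star (av O μ) = av O μ := by
  rw [av_eq h, star_sum]
  refine Finset.sum_congr rfl fun i _ => ?_
  rw [star_smul, star_trivial]
  congr 1
  cases i with
  | none => exact star_zero _
  | some q => exact hO q q.2

/-- simplices with close vertices -/
def Kx (O : Set (H →L[ℂ] H)) (η : ℝ) : Set (Finset (Option O)) :=
  {τ | ∀ a b : O, some a ∈ τ → some b ∈ τ → ‖(a : H →L[ℂ] H) - b‖ < η}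

lemma cc_close {O : Set (H →L[ℂ] H)} {η : ℝ} {τ : Finset (Option O)} (hτ : τ ∈ Kx O η)
    {μ : Option O → ℝ} (h : μ ∈ Dl τ) (h0 : μ none = 0) {q : O} (hq : some q ∈ τ) :
    ∀ i, μ i ≠ 0 → ‖cc O i - q‖ < η := by
  intro i hi
  have hiτ : i ∈ τ := by
    by_contra h'
    exact hi (h.2.1 i h')
  cases i with
  | none => exact absurd h0 hi
  | some a => exact hτ a q hiτ hq

lemma exists_G {M N : VonNeumannAlgebra H} {p : H →L[ℂ] H} (hp : IsPr p) (hpM : p ∈ M)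
    (hN : ∀ x, x ∈ N ↔ x ∈ M ∧ x * p = p * x) (hMi : PInf M) (hNi : PInf N) {η : ℝ}
    (hη : ∀ q a : H →L[ℂ] H, q ∈ Orb M p → a ∈ M → star a = a → ‖a - q‖ < η →
      IsUnit (sy a) ∧ Er a ∈ Orb M p ∧ ‖q - Er a‖ < 1) :
    ∃ G : (Option (Orb M p) → ℝ) → H →L[ℂ] H, ∀ τ ∈ Kx (Orb M p) η, ContinuousOn G (Dl τ) ∧
      ∀ μ ∈ Dl τ, IsU M (G μ) ∧ (μ none = 0 → G μ * p * star (G μ) = Er (av (Orb M p) μ)) := by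
  classical
  refine global_section (Kx (Orb M p) η) (fun τ hτ σ hσ a b ha hb => hτ a b (hσ ha) (hσ hb))
    (fun μ => {u | IsU M u ∧ (μ none = 0 → u * p * star u = Er (av (Orb M p) μ))}) ?_
  intro τ hτ f hf hfF
  by_cases hs : none ∈ τ
  · obtain ⟨g, hg, hgU, hgf⟩ := ext_vn hMi τ f hf fun μ hμ => (hfF μ hμ).1
    refine ⟨g, hg, fun μ hμ => ⟨hgU μ hμ, fun h0 => ?_⟩, hgf⟩
    have hb : μ ∈ Bd τ := ⟨hμ, none, hs, h0⟩
    rw [hgf μ hb]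
    exact (hfF μ hb).2 h0
  rcases τ.eq_empty_or_nonempty with rfl | ⟨i, hi⟩
  · have : Dl (∅ : Finset (Option (Orb M p))) = ∅ := by ext μ; simp [Dl]
    exact ⟨f, by simp [this], by simp [this], fun _ _ => rfl⟩
  obtain ⟨q, rfl⟩ : ∃ q, i = some q := by
    cases i with
    | none => exact absurd hi hs
    | some q => exact ⟨q, rfl⟩
  obtain ⟨u0, hu0, hq0⟩ := q.2
  have hqp : IsPr (q : H →L[ℂ] H) := Orb_pr hp q.2
  have hn0 : ∀ μ ∈ Dl τ, μ none = 0 := fun μ hμ => hμ.2.1 _ hs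
  have he : ∀ μ ∈ Dl τ, IsUnit (sy (av (Orb M p) μ)) ∧ Er (av (Orb M p) μ) ∈ Orb M p ∧
      ‖(q : H →L[ℂ] H) - Er (av (Orb M p) μ)‖ < 1 := fun μ hμ =>
    hη q _ q.2 (av_mem (fun q hq => Orb_mem hpM hq) hμ)
      (av_sa (fun q hq => (Orb_pr hp hq).2) hμ) (av_ball hμ (cc_close hτ hμ (hn0 μ hμ) hi))
  let e : (Option (Orb M p) → ℝ) → H →L[ℂ] H := fun μ => Er (av (Orb M p) μ)
  have hec : ContinuousOn e (Dl τ) := Er_cont.comp (av_cont _ τ) fun μ hμ => (he μ hμ).1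
  let S : (Option (Orb M p) → ℝ) → H →L[ℂ] H := fun μ => pol (sw (e μ) q) * u0
  have hwu : ∀ μ ∈ Dl τ, IsUnit (sw (e μ) q) := fun μ hμ =>
    sw_unit (Orb_pr hp (he μ hμ).2.1) hqp (he μ hμ).2.2
  have hSc : ContinuousOn S (Dl τ) := by
    refine ContinuousOn.mul ?_ continuousOn_const
    refine pol_cont.comp ?_ hwu
    unfold sw
    fun_prop
  have hSU : ∀ μ ∈ Dl τ, IsU M (S μ) := fun μ hμ =>
    (isU_pol (sw_mem (Orb_mem hpM (he μ hμ).2.1) (Orb_mem hpM q.2)) (hwu μ hμ)).mul hu0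
  have hSp : ∀ μ ∈ Dl τ, S μ * p * star (S μ) = e μ := by
    intro μ hμ
    have h1 : pol (sw (e μ) q) * q * star (pol (sw (e μ) q)) = e μ :=
      sw_conj (Orb_pr hp (he μ hμ).2.1) hqp (he μ hμ).2.2
    calc S μ * p * star (S μ) = pol (sw (e μ) q) * (u0 * p * star u0) *
          star (pol (sw (e μ) q)) := by
          simp only [S, star_mul, mul_assoc]
      _ = e μ := by rw [← hq0]; exact h1
  have hSp' : ∀ μ ∈ Dl τ, star (S μ) * e μ = p * star (S μ) := by
    intro μ hμ
    rw [← hSp μ hμ, mul_assoc (S μ), ← mul_assoc, (hSU μ hμ).2.1, one_mul]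
  obtain ⟨k, hkc, hkU, hkf⟩ := ext_vn hNi τ (fun μ => star (S μ) * f μ)
    ((hSc.mono fun μ hμ => hμ.1).star.mul hf) (by
      intro μ hμ
      have h1 := (hSU μ hμ.1).star.mul (hfF μ hμ).1
      refine ⟨(hN _).2 ⟨h1.1, ?_⟩, h1.2⟩
      have h2 : f μ * p = e μ * f μ := by
        have h3 : f μ * p * star (f μ) = e μ := (hfF μ hμ).2 (hn0 μ hμ.1)
        rw [← h3, mul_assoc, (hfF μ hμ).1.2.1, mul_one]
      rw [mul_assoc, h2, ← mul_assoc, hSp' μ hμ.1, mul_assoc])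
  refine ⟨fun μ => S μ * k μ, hSc.mul hkc, fun μ hμ => ?_, fun μ hμ => ?_⟩
  · have hkN := (hN _).1 (hkU μ hμ).1
    refine ⟨(hSU μ hμ).mul ⟨hkN.1, (hkU μ hμ).2⟩, fun _ => ?_⟩
    change S μ * k μ * p * star (S μ * k μ) = e μ
    rw [star_mul, mul_assoc (S μ), hkN.2, ← hSp μ hμ]
    have h3 := (hkU μ hμ).2.2
    calc S μ * (p * k μ) * (star (k μ) * star (S μ)) =
        S μ * p * (k μ * star (k μ)) * star (S μ) := by simp only [mul_assoc]
      _ = _ := by rw [h3, mul_one]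
  · beta_reduce
    rw [hkf μ hμ, ← mul_assoc, (hSU μ hμ.1).2.2, one_mul]

end VN
end UOC

set_option linter.unusedSimpArgs false
set_option linter.unusedVariables false
namespace UOC
section VN
variable {H : Type*} [NormedAddCommGroup H] [InnerProductSpace ℂ H] [CompleteSpace H]

/-- map to the nerve given by a partition of unity -/
lemma exists_m (O : Set (H →L[ℂ] H)) {η : ℝ} (hη : 0 < η) :
    ∃ m : O → Option O → ℝ, Continuous m ∧ (∀ x, m x none = 0) ∧
      (∀ x i, m x i ≠ 0 → ‖cc O i - x‖ < η) ∧
      ∀ x₀, ∃ F : Finset (Option O), ∀ᶠ y in nhds x₀, ∃ σ ⊆ F, σ ∈ Kx O η ∧ m y ∈ Dl σ := by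
  classical
  obtain ⟨ρ, hρ⟩ := PartitionOfUnity.exists_isSubordinate (X := O) (s := Set.univ) isClosed_univ
    (fun i : O => Metric.ball i (η / 2)) (fun i => Metric.isOpen_ball)
    (fun x _ => Set.mem_iUnion.2 ⟨x, Metric.mem_ball_self (by positivity)⟩)
  have hclose : ∀ x i : O, ρ i x ≠ 0 → ‖(i : H →L[ℂ] H) - x‖ < η / 2 := by
    intro x i h
    have h1 : x ∈ Metric.ball i (η / 2) := hρ i (subset_closure h)
    rw [Metric.mem_ball, Subtype.dist_eq, dist_eq_norm, norm_sub_rev] at h1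
    exact h1
  let m : O → Option O → ℝ := fun x i => match i with
    | none => 0
    | some j => ρ j x
  refine ⟨m, ?_, fun x => rfl, ?_, ?_⟩
  · refine continuous_pi fun i => ?_
    cases i with
    | none => exact continuous_const
    | some j => exact (ρ j).continuous
  · intro x i h
    cases i with
    | none => exact absurd rfl h
    | some j =>
      have := hclose x j h
      change ‖(j : H →L[ℂ] H) - x‖ < η
      linarith
  · intro x₀
    refine ⟨(ρ.fintsupport x₀).map Function.Embedding.some, ?_⟩
    filter_upwards [ρ.eventually_finsupport_subset x₀] with y hy
    refine ⟨(ρ.finsupport y).map Function.Embedding.some, Finset.map_subset_map.2 hy, ?_, ?_, ?_, ?_⟩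
    · intro a b ha hb
      have ha' : ρ a y ≠ 0 := by simpa using ha
      have hb' : ρ b y ≠ 0 := by simpa using hb
      have h1 := hclose y a ha'
      have h2 := hclose y b hb'
      rw [norm_sub_rev] at h2
      have h3 := norm_add_le ((a : H →L[ℂ] H) - y) ((y : H →L[ℂ] H) - b)
      rw [sub_add_sub_cancel] at h3
      linarith
    · intro i
      cases i with
      | none => exact le_refl (0 : ℝ)
      | some j => exact ρ.nonneg j y
    · intro i hi
      cases i with
      | none => rfl
      | some j =>
        by_contra h
        exact hi (by simpa using h)
    · rw [Finset.sum_map]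
      exact ρ.sum_finsupport (Set.mem_univ y)

/-- straight line to the cone point -/
noncomputable def mt {I : Type*} (t : ℝ) (μ : Option I → ℝ) : Option I → ℝ :=
  fun i => (1 - t) * μ i + t * (if i = none then 1 else 0)

lemma mt_mem {I : Type*} [DecidableEq I] {t : ℝ} (h0 : 0 ≤ t) (h1 : t ≤ 1) {μ : Option I → ℝ}
    {σ : Finset (Option I)} (h : μ ∈ Dl σ) : mt t μ ∈ Dl (insert none σ) := by
  have h' : μ ∈ Dl (insert none σ) := Dl_mono (Finset.subset_insert _ _) h
  refine ⟨fun i => ?_, fun i hi => ?_, ?_⟩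
  · have := h.1 i
    have h2 : (0 : ℝ) ≤ 1 - t := by linarith
    unfold mt
    split_ifs <;> positivity
  · have h2 := h'.2.1 i hi
    have h3 : i ≠ none := fun h => hi (by simp [h])
    simp [mt, h2, h3]
  · unfold mt
    rw [Finset.sum_add_distrib, ← Finset.mul_sum, h'.2.2, ← Finset.mul_sum]
    simp

lemma Kx_insert {O : Set (H →L[ℂ] H)} {η : ℝ} {σ : Finset (Option O)} [DecidableEq O]
    (h : σ ∈ Kx O η) : insert none σ ∈ Kx O η := by
  intro a b ha hb
  exact h a b (by simpa using ha) (by simpa using hb)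

lemma Phi_cont {O : Set (H →L[ℂ] H)} {η : ℝ} {m : O → Option O → ℝ} (hm : Continuous m)
    (hF : ∀ x₀, ∃ F : Finset (Option O), ∀ᶠ y in nhds x₀, ∃ σ ⊆ F, σ ∈ Kx O η ∧ m y ∈ Dl σ)
    {Y : Type*} [TopologicalSpace Y] (Φ : (Option O → ℝ) → Y)
    (hΦ : ∀ τ ∈ Kx O η, ContinuousOn Φ (Dl τ)) :
    Continuous fun z : unitInterval × O => Φ (mt z.1 (m z.2)) := by
  classical
  rw [continuous_iff_continuousAt]
  rintro ⟨t₀, x₀⟩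
  obtain ⟨F, hF⟩ := hF x₀
  let s : Finset (Finset (Option O)) := F.powerset.filter fun σ => σ ∈ Kx O η
  let C : Finset (Option O) → Set (unitInterval × O) := fun σ => {z | m z.2 ∈ Dl σ}
  have hmt : Continuous fun z : unitInterval × O => mt z.1 (m z.2) := by
    unfold mt
    refine continuous_pi fun i => ?_
    have : Continuous fun z : unitInterval × O => m z.2 i :=
      (continuous_apply i).comp (hm.comp continuous_snd)
    fun_prop
  have hc := contOn_biUnion s C
    (fun σ _ => (isClosed_Dl σ).preimage (hm.comp continuous_snd))
    (fun z : unitInterval × O => Φ (mt z.1 (m z.2))) (by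
      intro σ hσ
      have hσK : σ ∈ Kx O η := (Finset.mem_filter.1 hσ).2
      exact (hΦ _ (Kx_insert hσK)).comp hmt.continuousOn
        fun z hz => mt_mem z.1.2.1 z.1.2.2 hz)
  refine hc.continuousAt ?_
  have h2 : ∀ᶠ z : unitInterval × O in nhds (t₀, x₀), ∃ σ ⊆ F, σ ∈ Kx O η ∧ m z.2 ∈ Dl σ :=
    (continuous_snd.tendsto (t₀, x₀)).eventually hF
  filter_upwards [h2] with z hz
  obtain ⟨σ, h1, h2, h3⟩ := hz
  simp only [Set.mem_iUnion]
  exact ⟨σ, Finset.mem_filter.2 ⟨Finset.mem_powerset.2 h1, h2⟩, h3⟩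

lemma mt_zero {I : Type*} (μ : Option I → ℝ) : mt 0 μ = μ := by
  funext i; simp [mt]

lemma mt_one {I : Type*} (μ ν : Option I → ℝ) : mt 1 μ = mt 1 ν := by
  funext i; simp [mt]

theorem contractible_Orb {M : VonNeumannAlgebra H} {p : H →L[ℂ] H} (hpM : p ∈ M) (hp : p * p = p)
    (hps : star p = p) (h1 : IsProperlyInfiniteProj M p)
    (h2 : IsProperlyInfiniteProj M (1 - p)) : ContractibleSpace (Orb M p) := by
  classical
  have hpr : IsPr p := ⟨hp, hps⟩
  obtain ⟨N, hN⟩ := exists_relcomm M p hps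
  have hNi : PInf N := pinf_relcomm hp hps hN h1 h2
  have hMi : PInf M := by
    obtain ⟨v, hv, w, hw, h⟩ := hNi
    exact ⟨v, ((hN v).1 hv).1, w, ((hN w).1 hw).1, h⟩
  obtain ⟨η, hη0, hη⟩ := exists_eta (H := H)
  have hη' : ∀ q a : H →L[ℂ] H, q ∈ Orb M p → a ∈ M → star a = a → ‖a - q‖ < η →
      IsUnit (sy a) ∧ Er a ∈ Orb M p ∧ ‖q - Er a‖ < 1 := fun q a => hη M p q a hpr hpM
  obtain ⟨G, hG⟩ := exists_G hpr hpM hN hMi hNi hη'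
  obtain ⟨m, hmc, hm0, hmb, hmF⟩ := exists_m (Orb M p) hη0
  have hmD : ∀ x, ∃ σ ∈ Kx (Orb M p) η, m x ∈ Dl σ := by
    intro x
    obtain ⟨F, hF⟩ := hmF x
    obtain ⟨σ, -, h⟩ := hF.self_of_nhds
    exact ⟨σ, h⟩
  have havc : Continuous fun x : Orb M p => av (Orb M p) (m x) := by
    have := Phi_cont hmc hmF (av (Orb M p)) fun τ _ => av_cont _ τ
    have h3 := this.comp (Continuous.prodMk_right (0 : unitInterval))
    refine h3.congr fun x => ?_
    simp only [Function.comp, Set.Icc.coe_zero, mt_zero]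
  have hstar : ∀ q ∈ Orb M p, star q = q := fun q hq => (Orb_pr hpr hq).2
  have hmem : ∀ q ∈ Orb M p, q ∈ M := fun q hq => Orb_mem hpM hq
  let a : unitInterval × Orb M p → H →L[ℂ] H := fun z =>
    (1 - (z.1 : ℝ)) • (z.2 : H →L[ℂ] H) + (z.1 : ℝ) • av (Orb M p) (m z.2)
  have hac : Continuous a := by
    have := havc.comp (continuous_snd (X := unitInterval))
    simp only [Function.comp_def] at this
    fun_prop
  have ha : ∀ z, IsUnit (sy (a z)) ∧ Er (a z) ∈ Orb M p ∧ ‖(z.2 : H →L[ℂ] H) - Er (a z)‖ < 1 := by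
    rintro ⟨t, x⟩
    obtain ⟨σ, hσ, hD⟩ := hmD x
    refine hη' x _ x.2 ?_ ?_ ?_
    · exact add_mem (rsmul_mem' (hmem x x.2) _) (rsmul_mem' (av_mem hmem hD) _)
    · simp only [a, star_add, star_smul, star_trivial, hstar x x.2, av_sa hstar hD]
    · have h3 : a (t, x) - x = (t : ℝ) • (av (Orb M p) (m x) - x) := by
        simp only [a]; module
      rw [h3, norm_smul, Real.norm_of_nonneg t.2.1]
      have h4 := av_ball hD (hmb x)
      have h5 := t.2.2
      have h6 := norm_nonneg (av (Orb M p) (m x) - x)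
      have h7 := mul_le_of_le_one_left h6 h5
      linarith
  have hH1c : Continuous fun z => (⟨Er (a z), (ha z).2.1⟩ : Orb M p) := by
    refine Continuous.subtype_mk ?_ _
    exact Er_cont.comp_continuous hac fun z => (ha z).1
  have hmtD : ∀ z : unitInterval × Orb M p, ∃ σ ∈ Kx (Orb M p) η, mt z.1 (m z.2) ∈ Dl σ := by
    intro z
    obtain ⟨σ, hσ, hD⟩ := hmD z.2
    exact ⟨_, Kx_insert hσ, mt_mem z.1.2.1 z.1.2.2 hD⟩
  have hGU : ∀ z : unitInterval × Orb M p, IsU M (G (mt z.1 (m z.2))) := by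
    intro z
    obtain ⟨σ, hσ, hD⟩ := hmtD z
    exact ((hG σ hσ).2 _ hD).1
  have hGc := Phi_cont hmc hmF G fun τ hτ => (hG τ hτ).1
  have hH2c : Continuous fun z : unitInterval × Orb M p =>
      (⟨G (mt z.1 (m z.2)) * p * star (G (mt z.1 (m z.2))), ⟨_, hGU z, rfl⟩⟩ : Orb M p) := by
    refine Continuous.subtype_mk ?_ _
    exact (hGc.mul continuous_const).mul hGc.star
  rw [contractible_iff_id_nullhomotopic]
  let x₀ : Orb M p := ⟨p, 1, IsU.one M, by simp⟩
  let r : C(Orb M p, Orb M p) := ⟨fun x => ⟨Er (a (1, x)), (ha (1, x)).2.1⟩,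
    hH1c.comp (Continuous.prodMk_right (1 : unitInterval))⟩
  let y₀ : Orb M p := ⟨G (mt 1 (m x₀)) * p * star (G (mt 1 (m x₀))),
    ⟨_, by simpa using hGU (1, x₀), rfl⟩⟩
  refine ⟨y₀, ContinuousMap.Homotopic.trans (g := r) ⟨⟨⟨_, hH1c⟩, ?_, ?_⟩⟩ ⟨⟨⟨_, hH2c⟩, ?_, ?_⟩⟩⟩
  · intro x
    apply Subtype.ext
    simp [a, Er_eq (Orb_pr hpr x.2)]
  · intro x
    rfl
  · intro x
    apply Subtype.ext
    obtain ⟨σ, hσ, hD⟩ := hmD x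
    have := ((hG σ hσ).2 _ hD).2 (hm0 x)
    simp [r, a, mt_zero, this]
  · intro x
    apply Subtype.ext
    simp [y₀, mt_one (m x) (m x₀)]

end VN
end UOC

theorem unitary_orbit_contractible {H : Type*} [NormedAddCommGroup H]
    [InnerProductSpace ℂ H] [CompleteSpace H]
    (M : VonNeumannAlgebra H) (p : H →L[ℂ] H) (hpM : p ∈ M)
    (hp : p * p = p) (hps : star p = p)
    (hM : IsProperlyInfiniteProj M 1)
    (hpInf : IsProperlyInfiniteProj M p)
    (hpcInf : IsProperlyInfiniteProj M (1 - p)) :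
    ContractibleSpace
      {q : H →L[ℂ] H // ∃ u ∈ M, star u * u = 1 ∧ u * star u = 1 ∧ q = u * p * star u} := by
  have h := UOC.contractible_Orb hpM hp hps hpInf hpcInf
  have e : UOC.Orb M p =
      {q : H →L[ℂ] H | ∃ u ∈ M, star u * u = 1 ∧ u * star u = 1 ∧ q = u * p * star u} := by
    ext q
    constructor
    · rintro ⟨u, hu, hq⟩
      exact ⟨u, hu.1, hu.2.1, hu.2.2, hq⟩
    · rintro ⟨u, h1, h2, h3, hq⟩
      exact ⟨u, ⟨h1, h2, h3⟩, hq⟩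
  rw [e] at h
  exact h
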